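/- Let P be a simple polygon, Π a connected curve contained in P intersecting every nonredundant cut of P, Q the subpolygon of P obtained by cutting P along all nonredundant cuts, and v_i a reflex vertex of Q with adjacent vertices t_{i1}, t_{i2} and associated cuts l_{i1}, l_{i2} of Q generated by the edges t_{i1}v_i and t_{i2}v_i. If, for some j ∈ {1,2}, the pocket Pocket(l_{ij}) (taken in P) contains the pocket of every nonredundant cut of P, then the vertex t_{ij} is visible from some point of Π. -/

import Mathlib

open Set

noncomputable section

/-- The Euclidean plane. -/
abbrev E2 := EuclideanSpace ℝ (Fin 2)

/-- A simple polygon in the plane, given by its cyclic sequence of vertices.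
Adjacent edges meet exactly at their common vertex, and non-adjacent edges
are disjoint, so the boundary is a simple closed polygonal curve. -/
structure SimplePolygon where
  n : ℕ
  three_le : 3 ≤ n
  vtx : ZMod n → E2
  inj : Function.Injective vtx
  adj_edges : ∀ i : ZMod n,
    segment ℝ (vtx i) (vtx (i + 1)) ∩ segment ℝ (vtx (i + 1)) (vtx (i + 2)) = {vtx (i + 1)}
  nonadj_edges : ∀ i j : ZMod n, i ≠ j → i + 1 ≠ j → j + 1 ≠ i →
    segment ℝ (vtx i) (vtx (i + 1)) ∩ segment ℝ (vtx j) (vtx (j + 1)) = ∅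

namespace SimplePolygon

variable (P : SimplePolygon)

/-- The boundary `∂P`: the union of the edges. -/
def boundary : Set E2 := ⋃ i : ZMod P.n, segment ℝ (P.vtx i) (P.vtx (i + 1))

/-- The compact region bounded by `∂P`: the boundary together with all points of the
bounded connected components of its complement. -/
def region : Set E2 :=
  P.boundary ∪ {x | x ∉ P.boundary ∧ Bornology.IsBounded (connectedComponentIn P.boundaryᶜ x)}

/-- `x` sees `y` (in `P`) if the closed segment `[x,y]` is contained in `P`. -/
def Visible (x y : E2) : Prop := segment ℝ x y ⊆ P.region

/-- The vertex `vtx i` is reflex: its internal angle is strictly larger than `π`, i.e.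
near the vertex the midpoint of two points at equal small parameter along the two
incident edges lies outside the region. -/
def IsReflex (i : ZMod P.n) : Prop :=
  ∃ ε₀ > (0 : ℝ), ∀ ε ∈ Set.Ioo (0 : ℝ) ε₀,
    midpoint ℝ (P.vtx i + ε • (P.vtx (i - 1) - P.vtx i))
               (P.vtx i + ε • (P.vtx (i + 1) - P.vtx i)) ∉ P.region

/-- `P` is star-shaped if a single point of `P` sees all of `P`. -/
def IsStarShaped : Prop := ∃ x ∈ P.region, ∀ y ∈ P.region, P.Visible x y

/-- A visibility path: a connected curve inside `P` from which every point of `P`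
is visible. -/
def IsVisibilityPath (Pth : Set E2) : Prop :=
  IsConnected Pth ∧ Pth ⊆ P.region ∧ ∀ x ∈ P.region, ∃ p ∈ Pth, P.Visible x p

/-- The pocket, inside `P`, determined by a cut segment `s` on the side of the point `u`:
the closure of the connected component of `P \ s` containing `u`, together with `s`. -/
def pocketOfSeg (s : Set E2) (u : E2) : Set E2 :=
  closure (connectedComponentIn (P.region \ s) u) ∪ s

end SimplePolygon

/-- A cut of a simple polygon `P`: for a reflex vertex `v = vtx i` with adjacent
vertex `u = vtx j`, the segment from `v` to the closest point `w` of `∂P` hit by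
the ray from `v` in the direction from `u` to `v`. -/
structure SimplePolygon.Cut (P : SimplePolygon) where
  i : ZMod P.n
  j : ZMod P.n
  adj : j = i + 1 ∨ j = i - 1
  reflex : P.IsReflex i
  t : ℝ
  t_pos : 0 < t
  hits : P.vtx i + t • (P.vtx i - P.vtx j) ∈ P.boundary
  first_hit : ∀ s ∈ Set.Ioo (0 : ℝ) t, P.vtx i + s • (P.vtx i - P.vtx j) ∉ P.boundary
  inside : segment ℝ (P.vtx i) (P.vtx i + t • (P.vtx i - P.vtx j)) ⊆ P.region

namespace SimplePolygon.Cut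

variable {P : SimplePolygon} (C : P.Cut)

/-- The reflex vertex generating the cut. -/
def v : E2 := P.vtx C.i

/-- The adjacent vertex `u`; the edge `u v` is the generator of the cut. -/
def u : E2 := P.vtx C.j

/-- The other endpoint of the cut, on `∂P`. -/
def w : E2 := P.vtx C.i + C.t • (P.vtx C.i - P.vtx C.j)

/-- The cut as a segment. -/
def seg : Set E2 := segment ℝ C.v C.w

/-- `Pocket(C)`: the part of `P` cut off by `C` that contains the generator vertex `u`. -/
def pocket : Set E2 := P.pocketOfSeg C.seg C.u

/-- A cut is redundant if the pocket of some cut is strictly contained in its pocket. -/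
def Redundant : Prop := ∃ C' : P.Cut, C'.pocket ⊂ C.pocket

/-- A nonredundant (essential) cut. -/
def Nonredundant : Prop := ¬ C.Redundant

/-- `x` is a vertex of the polygon `Pocket(C)`: either the endpoint `w` of the cut, or a
vertex of `P` belonging to the pocket. -/
def PocketVertex (x : E2) : Prop :=
  x = C.w ∨ ∃ k : ZMod P.n, P.vtx k = x ∧ x ∈ C.pocket

end SimplePolygon.Cut

/-- Length of a polygonal path given by its list of vertices. -/
def polyLength (l : List E2) : ℝ := ((l.zip l.tail).map fun p => dist p.1 p.2).sum

namespace SimplePolygon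

variable (P : SimplePolygon)

/-- A polygonal path inside `P`: a nonempty list of points with each consecutive
segment contained in `P`. -/
def IsPolyPathIn (l : List E2) : Prop :=
  l ≠ [] ∧ List.Chain' (fun a b => segment ℝ a b ⊆ P.region) l

/-- `l` is a shortest Euclidean (polygonal) path inside `P` from `x` to the set `S`. -/
def IsGeodesicTo (x : E2) (S : Set E2) (l : List E2) : Prop :=
  P.IsPolyPathIn l ∧ l.head? = some x ∧ (∃ y ∈ S, l.getLast? = some y) ∧
  ∀ m : List E2, P.IsPolyPathIn m → m.head? = some x →
    (∃ y ∈ S, m.getLast? = some y) → polyLength l ≤ polyLength m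

/-- The subpolygon `Q` of `P` obtained by cutting `P` along all nonredundant cuts:
the closure of `P` minus the union of the pockets of all nonredundant cuts. -/
def core : Set E2 :=
  closure (P.region \ ⋃ C : {C : P.Cut // C.Nonredundant}, (C : P.Cut).pocket)

end SimplePolygon

/-- The planar cross product. -/
def cross2 (a b : E2) : ℝ := a 0 * b 1 - a 1 * b 0

/-- A polygonal chain all of whose turns have the sign `s` (a convex chain bending
consistently to one side). -/
def ConvexChain (s : ℝ) (l : List E2) : Prop :=
  ∀ p q r : E2, [p, q, r] <:+: l → 0 ≤ s * cross2 (q - p) (r - q)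

/-! ### Oriented area forms on the plane -/

/-- The cross product scaled by `σ`; the sign of `σ` chooses an orientation of the plane. -/
def orientedCross (σ : ℝ) (a b : E2) : ℝ := σ * cross2 a b

section OrientedCross

variable (σ : ℝ) (a b c : E2) (t : ℝ)

theorem orientedCross_add_left :
    orientedCross σ (a + b) c = orientedCross σ a c + orientedCross σ b c := by
  simp [orientedCross, cross2]; ring

theorem orientedCross_add_right :
    orientedCross σ a (b + c) = orientedCross σ a b + orientedCross σ a c := by
  simp [orientedCross, cross2]; ring

theorem orientedCross_smul_left : orientedCross σ (t • a) b = t * orientedCross σ a b := by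
  simp [orientedCross, cross2]; ring

theorem orientedCross_smul_right : orientedCross σ a (t • b) = t * orientedCross σ a b := by
  simp [orientedCross, cross2]; ring

theorem orientedCross_neg_left : orientedCross σ (-a) b = -orientedCross σ a b := by
  simp [orientedCross, cross2]; ring

theorem orientedCross_neg_right : orientedCross σ a (-b) = -orientedCross σ a b := by
  simp [orientedCross, cross2]; ring

theorem orientedCross_sub_right :
    orientedCross σ a (b - c) = orientedCross σ a b - orientedCross σ a c := by
  simp [orientedCross, cross2]; ring

theorem orientedCross_self : orientedCross σ a a = 0 := by
  simp [orientedCross, cross2]; ring_nf; simp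

theorem orientedCross_swap : orientedCross σ a b = -orientedCross σ b a := by
  simp [orientedCross, cross2]; ring

/-- Cramer's rule in the plane. -/
theorem orientedCross_cramer :
    orientedCross σ a b • c = orientedCross σ c b • a + orientedCross σ a c • b := by
  ext i
  fin_cases i <;> simp [orientedCross, cross2] <;> ring

variable {σ a b}

theorem exists_smul_of_orientedCross_eq_zero (hσ : σ ≠ 0) (ha : a ≠ 0)
    (h : orientedCross σ a b = 0) : ∃ t : ℝ, b = t • a := by
  have h0 : a 0 * b 1 - a 1 * b 0 = 0 := by
    simpa [orientedCross, cross2, hσ] using h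
  by_cases h1 : a 0 = 0
  · have h2 : a 1 ≠ 0 := fun h2 => ha (by ext i; fin_cases i <;> simp [h1, h2])
    refine ⟨b 1 / a 1, ?_⟩
    have h3 : b 0 = 0 := by
      rw [h1] at h0
      have : a 1 * b 0 = 0 := by linarith
      simpa [h2] using this
    ext i; fin_cases i <;> simp [h1, h2, h3]
  · refine ⟨b 0 / a 0, ?_⟩
    ext i; fin_cases i
    · simp [h1]
    · simp only [Fin.mk_one, PiLp.smul_apply, smul_eq_mul]
      field_simp
      linarith

theorem exists_orientedCross_pos (hσ : σ ≠ 0) (ha : a ≠ 0) : ∃ g, 0 < orientedCross σ a g := by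
  by_contra! H
  have h1 := H !₂[1, 0]
  have h2 := H !₂[0, 1]
  have h3 := H (-!₂[1, 0])
  have h4 := H (-!₂[0, 1])
  rw [orientedCross_neg_right] at h3 h4
  have h5 : orientedCross σ a !₂[1, 0] = 0 := by linarith
  have h6 : orientedCross σ a !₂[0, 1] = 0 := by linarith
  simp [orientedCross, cross2, hσ] at h5 h6
  exact ha (by ext i; fin_cases i <;> simp [h5, h6])

end OrientedCross

/-! ### Sectors -/

/-- `v` lies strictly inside the sector swept from the direction `a` to the direction `b`,
turning in the positive sense of the orientation `σ`. -/
def InSector (σ : ℝ) (a b v : E2) : Prop :=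
  (0 < orientedCross σ a b ∧ 0 < orientedCross σ a v ∧ 0 < orientedCross σ v b) ∨
  (orientedCross σ a b ≤ 0 ∧ (0 < orientedCross σ a v ∨ 0 < orientedCross σ v b))

/-- `v` lies on the closed ray spanned by `a`. -/
def OnRay (a v : E2) : Prop := ∃ t : ℝ, 0 ≤ t ∧ v = t • a

section Sector

variable {σ : ℝ} {a b v : E2}

theorem InSector.smul (h : InSector σ a b v) {t : ℝ} (ht : 0 < t) : InSector σ a b (t • v) := by
  simpa [InSector, orientedCross_smul_left, orientedCross_smul_right, ht] using h

/-- Two directions that do not span the same ray but are linearly dependent are opposite. -/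
theorem exists_neg_smul_of_orientedCross_eq_zero (hσ : σ ≠ 0) (ha : a ≠ 0) (hb : b ≠ 0)
    (hab : ¬ OnRay a b) (h : orientedCross σ a b = 0) : ∃ t : ℝ, 0 < t ∧ b = -(t • a) := by
  obtain ⟨t, rfl⟩ := exists_smul_of_orientedCross_eq_zero hσ ha h
  refine ⟨-t, ?_, by simp⟩
  by_contra! H
  exact hab ⟨t, by linarith, rfl⟩

theorem inSector_or_onRay (hσ : σ ≠ 0) (ha : a ≠ 0) (hb : b ≠ 0) (hab : ¬ OnRay a b) (v : E2) :
    InSector σ a b v ∨ InSector σ b a v ∨ OnRay a v ∨ OnRay b v := by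
  wlog h : 0 ≤ orientedCross σ a b generalizing a b
  · have hba : ¬ OnRay b a := by
      rintro ⟨t, ht, rfl⟩
      apply h
      rw [orientedCross_smul_left, orientedCross_self, mul_zero]
    have := this hb ha hba (by rw [orientedCross_swap]; linarith)
    tauto
  have e1 := orientedCross_swap σ b a
  have e2 := orientedCross_swap σ b v
  have e3 := orientedCross_swap σ v a
  rcases h.eq_or_lt with h | h
  · obtain ⟨t, ht, rfl⟩ := exists_neg_smul_of_orientedCross_eq_zero hσ ha hb hab h.symm
    rcases lt_trichotomy (orientedCross σ a v) 0 with h1 | h1 | h1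
    · right; left; right
      exact ⟨by linarith, Or.inr (by linarith)⟩
    · obtain ⟨s, rfl⟩ := exists_smul_of_orientedCross_eq_zero hσ ha h1
      right; right
      rcases le_total 0 s with hs | hs
      · exact Or.inl ⟨s, hs, rfl⟩
      · refine Or.inr ⟨-s / t, by apply div_nonneg <;> linarith, ?_⟩
        rw [← neg_smul, smul_smul]
        congr 1
        field_simp
    · left; right
      exact ⟨by linarith, Or.inl h1⟩
  · by_cases h1 : 0 < orientedCross σ v a
    · exact Or.inr (Or.inl (Or.inr ⟨by linarith, Or.inr h1⟩))
    by_cases h2 : 0 < orientedCross σ b v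
    · exact Or.inr (Or.inl (Or.inr ⟨by linarith, Or.inl h2⟩))
    have hc := orientedCross_cramer σ a b v
    have hv : v = (orientedCross σ v b / orientedCross σ a b) • a
        + (orientedCross σ a v / orientedCross σ a b) • b := by
      rw [div_eq_inv_mul, div_eq_inv_mul, mul_smul, mul_smul, ← smul_add, ← hc, smul_smul,
        inv_mul_cancel₀ h.ne', one_smul]
    rcases (show 0 ≤ orientedCross σ a v by linarith).eq_or_lt with h3 | h3
    · refine Or.inr (Or.inr (Or.inl ⟨orientedCross σ v b / orientedCross σ a b,
        div_nonneg (by linarith) h.le, ?_⟩))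
      rw [← h3] at hv
      simpa using hv
    · rcases (show 0 ≤ orientedCross σ v b by linarith).eq_or_lt with h4 | h4
      · refine Or.inr (Or.inr (Or.inr ⟨_, div_nonneg h3.le h.le, ?_⟩))
        rw [← h4] at hv
        simpa using hv
      · exact Or.inl (Or.inl ⟨h, h3, h4⟩)

/-- A direction which, added to any vector on either bounding ray, points into the sector. -/
theorem exists_inSector_add (hσ : σ ≠ 0) (ha : a ≠ 0) (hb : b ≠ 0) (hab : ¬ OnRay a b) :
    ∃ g, ∀ t ≥ (0 : ℝ), ∀ ε > (0 : ℝ),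
      InSector σ a b (t • a + ε • g) ∧ InSector σ a b (t • b + ε • g) := by
  rcases lt_trichotomy (orientedCross σ a b) 0 with h | h | h
  · refine ⟨-(a + b), fun t ht ε hε => ⟨Or.inr ⟨h.le, Or.inl ?_⟩, Or.inr ⟨h.le, Or.inr ?_⟩⟩⟩ <;>
    · simp only [orientedCross_add_left, orientedCross_add_right, orientedCross_smul_left,
        orientedCross_smul_right, orientedCross_neg_left, orientedCross_neg_right,
        orientedCross_self]
      nlinarith
  · obtain ⟨g, hg⟩ := exists_orientedCross_pos hσ ha
    obtain ⟨s, hs, rfl⟩ := exists_neg_smul_of_orientedCross_eq_zero hσ ha hb hab h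
    refine ⟨g, fun t ht ε hε => ⟨Or.inr ⟨h.le, Or.inl ?_⟩, Or.inr ⟨h.le, Or.inl ?_⟩⟩⟩ <;>
    · simp only [orientedCross_add_right, orientedCross_smul_right, orientedCross_neg_right,
        orientedCross_self]
      have := mul_pos hε hg
      linarith
  · refine ⟨a + b, fun t ht ε hε => ⟨Or.inl ⟨h, ?_, ?_⟩, Or.inl ⟨h, ?_, ?_⟩⟩⟩ <;>
    · simp only [orientedCross_add_left, orientedCross_add_right, orientedCross_smul_left,
        orientedCross_smul_right, orientedCross_self]
      have := mul_pos hε h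
      have := mul_nonneg ht h.le
      linarith

theorem not_onRay_of_inSector (h : InSector σ a b v) : ¬ OnRay a v ∧ ¬ OnRay b v := by
  constructor
  · rintro ⟨t, ht, rfl⟩
    simp only [InSector, orientedCross_smul_left, orientedCross_smul_right,
      orientedCross_self] at h
    rcases h with h | ⟨h, h' | h'⟩ <;> nlinarith
  · rintro ⟨t, ht, rfl⟩
    simp only [InSector, orientedCross_smul_left, orientedCross_smul_right,
      orientedCross_self] at h
    rcases h with h | ⟨h, h' | h'⟩ <;> nlinarith

theorem convex_orientedCross_pos_ball (a : E2) (r : ℝ) :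
    Convex ℝ ({v | 0 < orientedCross σ a v} ∩ Metric.ball 0 r) := by
  refine Convex.inter ?_ (convex_ball _ _)
  intro x hx y hy s t hs ht hst
  simp only [mem_ofPred_eq, orientedCross_add_right, orientedCross_smul_right] at *
  rcases hs.eq_or_lt with rfl | hs
  · have : t = 1 := by linarith
    subst this; linarith
  · have := mul_pos hs hx
    have := mul_nonneg ht hy.le
    linarith

theorem isPreconnected_inSector_inter_ball (hσ : σ ≠ 0) (ha : a ≠ 0) (hb : b ≠ 0)
    (hab : ¬ OnRay a b) {r : ℝ} (hr : 0 < r) :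
    IsPreconnected ({v | InSector σ a b v} ∩ Metric.ball 0 r) := by
  have e : ∀ v, orientedCross σ v b = orientedCross σ (-b) v := fun v => by
    rw [orientedCross_neg_left, ← orientedCross_swap]
  have hA := convex_orientedCross_pos_ball (σ := σ) a r
  have hB := convex_orientedCross_pos_ball (σ := σ) (-b) r
  by_cases h : 0 < orientedCross σ a b
  · convert (hA.inter hB).isPreconnected using 1
    ext v
    have hv := e v
    simp only [mem_inter_iff, mem_ofPred_eq, InSector, ← hv, h, not_le.2 h, true_and, false_and,
      or_false]
    tauto
  · obtain ⟨g, hg1, hg2⟩ : ∃ g, 0 < orientedCross σ a g ∧ 0 < orientedCross σ (-b) g := by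
      rcases (not_lt.1 h).eq_or_lt with h0 | h0
      · obtain ⟨g, hg⟩ := exists_orientedCross_pos hσ ha
        obtain ⟨s, hs, rfl⟩ := exists_neg_smul_of_orientedCross_eq_zero hσ ha hb hab h0
        refine ⟨g, hg, ?_⟩
        rw [neg_neg, orientedCross_smul_left]
        positivity
      · refine ⟨-(a + b), ?_, ?_⟩
        · simp only [orientedCross_neg_right, orientedCross_add_right, orientedCross_self]
          linarith
        · rw [orientedCross_swap]
          simp only [orientedCross_neg_right, orientedCross_neg_left, orientedCross_add_left,
            orientedCross_self]
          linarith
    have hU : {v | InSector σ a b v} ∩ Metric.ball 0 r =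
        ({v | 0 < orientedCross σ a v} ∩ Metric.ball 0 r) ∪
        ({v | 0 < orientedCross σ (-b) v} ∩ Metric.ball 0 r) := by
      ext v
      have hv := e v
      simp only [mem_inter_iff, mem_union, mem_ofPred_eq, InSector, ← hv, h, not_lt.1 h, true_and,
        false_and, false_or]
      tauto
    rw [hU]
    have hn : (0 : ℝ) < r / (2 * (‖g‖ + 1)) := by positivity
    have hmem : (r / (2 * (‖g‖ + 1))) • g ∈ Metric.ball (0 : E2) r := by
      rw [mem_ball_zero_iff, norm_smul, Real.norm_of_nonneg hn.le, div_mul_eq_mul_div,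
        div_lt_iff₀ (by positivity)]
      nlinarith [norm_nonneg g]
    refine IsPreconnected.union ((r / (2 * (‖g‖ + 1))) • g) ⟨?_, hmem⟩ ⟨?_, hmem⟩
      hA.isPreconnected hB.isPreconnected
    · simp only [mem_ofPred_eq, orientedCross_smul_right]; positivity
    · simp only [mem_ofPred_eq, orientedCross_smul_right]; positivity

end Sector

namespace SimplePolygon

variable (P : SimplePolygon)

/-! ### Topology of the region -/

instance : NeZero P.n := ⟨by have := P.three_le; omega⟩

instance : Fact (1 < P.n) := ⟨by have := P.three_le; omega⟩

/-- The points of the region off the boundary curve. -/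
def inner : Set E2 := P.region \ P.boundary

theorem edge_subset_boundary (i : ZMod P.n) :
    segment ℝ (P.vtx i) (P.vtx (i + 1)) ⊆ P.boundary :=
  subset_iUnion (fun i : ZMod P.n => segment ℝ (P.vtx i) (P.vtx (i + 1))) i

theorem boundary_subset_region : P.boundary ⊆ P.region := subset_union_left

theorem vtx_mem_boundary (i : ZMod P.n) : P.vtx i ∈ P.boundary :=
  P.edge_subset_boundary i (left_mem_segment ℝ _ _)

theorem isCompact_boundary : IsCompact P.boundary := by
  refine isCompact_iUnion fun i => ?_
  rw [segment_eq_image_lineMap]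
  exact isCompact_Icc.image AffineMap.lineMap_continuous

theorem isClosed_boundary : IsClosed P.boundary := P.isCompact_boundary.isClosed

variable {P}

theorem mem_region_iff {x : E2} (hx : x ∉ P.boundary) :
    x ∈ P.region ↔ Bornology.IsBounded (connectedComponentIn P.boundaryᶜ x) := by
  simp [region, hx]

theorem mem_region_iff_of_preconnected {S : Set E2} (hS : IsPreconnected S)
    (hd : S ⊆ P.boundaryᶜ) {x y : E2} (hx : x ∈ S) (hy : y ∈ S) :
    x ∈ P.region ↔ y ∈ P.region := by
  rw [mem_region_iff (hd hx), mem_region_iff (hd hy),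
    connectedComponentIn_eq (hS.subset_connectedComponentIn hx hd hy)]

theorem inner_of_preconnected {S : Set E2} (hS : IsPreconnected S)
    (hd : S ⊆ P.boundaryᶜ) {x : E2} (hx : x ∈ S) (h : x ∈ P.region) : S ⊆ P.inner :=
  fun _ hy => ⟨(mem_region_iff_of_preconnected hS hd hx hy).1 h, hd hy⟩

theorem compl_of_preconnected {S : Set E2} (hS : IsPreconnected S)
    (hd : S ⊆ P.boundaryᶜ) {x : E2} (hx : x ∈ S) (h : x ∉ P.region) : S ⊆ P.regionᶜ :=
  fun _ hy h' => h ((mem_region_iff_of_preconnected hS hd hx hy).2 h')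

variable (P)

theorem isOpen_inner : IsOpen P.inner := by
  refine isOpen_iff_forall_mem_open.2 fun x hx => ?_
  have hx' : x ∈ P.boundaryᶜ := hx.2
  exact ⟨connectedComponentIn P.boundaryᶜ x,
    inner_of_preconnected isPreconnected_connectedComponentIn (connectedComponentIn_subset _ _)
      (mem_connectedComponentIn hx') hx.1,
    P.isClosed_boundary.isOpen_compl.connectedComponentIn, mem_connectedComponentIn hx'⟩

theorem isClosed_region : IsClosed P.region := by
  rw [← isOpen_compl_iff]
  refine isOpen_iff_forall_mem_open.2 fun x hx => ?_
  have hxb : x ∈ P.boundaryᶜ := fun h => hx (P.boundary_subset_region h)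
  exact ⟨connectedComponentIn P.boundaryᶜ x,
    compl_of_preconnected isPreconnected_connectedComponentIn (connectedComponentIn_subset _ _)
      (mem_connectedComponentIn hxb) hx,
    P.isClosed_boundary.isOpen_compl.connectedComponentIn, mem_connectedComponentIn hxb⟩

/-- A ray from a point of the region that avoids the boundary cannot exist. -/
theorem exists_boundary_on_ray {x v : E2} (hx : x ∈ P.region) (hv : v ≠ 0) :
    ∃ t ≥ (0 : ℝ), x + t • v ∈ P.boundary := by
  by_contra! H
  set f : ℝ → E2 := fun t => x + t • v with hf
  have hfc : Continuous f := by fun_prop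
  have hpre : IsPreconnected (f '' Ici 0) := isPreconnected_Ici.image _ hfc.continuousOn
  have hd : f '' Ici 0 ⊆ P.boundaryᶜ := by
    rintro _ ⟨t, ht, rfl⟩
    exact H t ht
  have hx0 : x ∈ f '' Ici 0 := ⟨0, by simp, by simp [hf]⟩
  have hb := (mem_region_iff (hd hx0)).1 hx
  obtain ⟨M, hM⟩ := (hb.subset (hpre.subset_connectedComponentIn hx0 hd)).exists_norm_le
  have hv' : 0 < ‖v‖ := norm_pos_iff.2 hv
  have hM0 : 0 ≤ M := (norm_nonneg _).trans (hM x hx0)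
  have h1 := hM (f ((M + ‖x‖ + 1) / ‖v‖)) ⟨_, by simp only [mem_Ici]; positivity, rfl⟩
  have h2 : ‖((M + ‖x‖ + 1) / ‖v‖) • v‖ ≤ ‖f ((M + ‖x‖ + 1) / ‖v‖)‖ + ‖x‖ := by
    have := norm_sub_le (f ((M + ‖x‖ + 1) / ‖v‖)) x
    simpa [hf] using this
  rw [norm_smul, Real.norm_of_nonneg (by positivity), div_mul_cancel₀ _ hv'.ne'] at h2
  linarith

theorem isBounded_region : Bornology.IsBounded P.region := by
  obtain ⟨M, hM⟩ := P.isCompact_boundary.isBounded.exists_norm_le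
  refine isBounded_iff_forall_norm_le.2 ⟨M, fun x hx => ?_⟩
  by_contra! h
  have hM0 : 0 ≤ M := (norm_nonneg _).trans (hM _ (P.vtx_mem_boundary 0))
  have hx0 : x ≠ 0 := by rintro rfl; simp at h; linarith
  obtain ⟨t, ht, hb⟩ := P.exists_boundary_on_ray hx hx0
  have := hM _ hb
  rw [show x + t • x = (1 + t) • x by rw [add_smul, one_smul], norm_smul,
    Real.norm_of_nonneg (by linarith)] at this
  nlinarith [norm_nonneg x]

/-- A ray that starts inside the region stays inside up to its first hit with the boundary. -/
theorem exists_first_hit {x v : E2} (hv : v ≠ 0) {δ : ℝ} (hδ : 0 < δ)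
    (h : ∀ t ∈ Ioo 0 δ, x + t • v ∈ P.inner) :
    ∃ t > (0 : ℝ), x + t • v ∈ P.boundary ∧ ∀ s ∈ Ioo 0 t, x + s • v ∈ P.inner := by
  set f : ℝ → E2 := fun t => x + t • v with hf
  have hfc : Continuous f := by fun_prop
  obtain ⟨t, ht, hb⟩ := P.exists_boundary_on_ray
    (h (δ / 2) ⟨by linarith, by linarith⟩).1 hv
  have hset : IsClosed (Ici (δ / 2) ∩ f ⁻¹' P.boundary) :=
    isClosed_Ici.inter (P.isClosed_boundary.preimage hfc)
  have hne : (Ici (δ / 2) ∩ f ⁻¹' P.boundary).Nonempty := by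
    refine ⟨δ / 2 + t, by simp only [mem_Ici]; linarith, ?_⟩
    simpa [hf, add_smul, add_assoc] using hb
  have hbdd : BddBelow (Ici (δ / 2) ∩ f ⁻¹' P.boundary) := ⟨δ / 2, fun y hy => hy.1⟩
  have hmem := hset.csInf_mem hne hbdd
  set t₀ := sInf (Ici (δ / 2) ∩ f ⁻¹' P.boundary)
  have h1 : δ / 2 ≤ t₀ := hmem.1
  have hoff : ∀ s ∈ Ioo 0 t₀, f s ∉ P.boundary := by
    intro s hs hsb
    by_cases h2 : s < δ / 2
    · exact (h s ⟨hs.1, by linarith⟩).2 hsb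
    · exact absurd (csInf_le hbdd ⟨not_lt.1 h2, hsb⟩) (not_le.2 hs.2)
  refine ⟨t₀, by linarith, hmem.2, fun s hs => ?_⟩
  have hpre : IsPreconnected (f '' Ioo 0 t₀) := isPreconnected_Ioo.image _ hfc.continuousOn
  refine inner_of_preconnected hpre ?_ (x := f (min (δ / 2) (t₀ / 2))) ⟨_, ?_, rfl⟩ ?_ ⟨s, hs, rfl⟩
  · rintro _ ⟨s, hs, rfl⟩
    exact hoff s hs
  · constructor
    · apply lt_min <;> linarith
    · exact (min_le_right _ _).trans_lt (by linarith)
  · refine (h _ ⟨lt_min (by linarith) (by linarith), (min_le_left _ _).trans_lt (by linarith)⟩).1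

/-! ### Polygonal chains inside the region -/

/-- `a` and `b` are joined by a polygonal chain inside the region. -/
def Joined : E2 → E2 → Prop := Relation.ReflTransGen fun a b => segment ℝ a b ⊆ P.region

variable {P}

theorem Joined.symm {a b : E2} (h : P.Joined a b) : P.Joined b a := by
  induction h with
  | refl => exact Relation.ReflTransGen.refl
  | tail _ h ih => exact Relation.ReflTransGen.head (by rwa [segment_symm]) ih

theorem joined_vtx (i j : ZMod P.n) : P.Joined (P.vtx i) (P.vtx j) := by
  have key : ∀ (k : ℕ) (i : ZMod P.n), P.Joined (P.vtx i) (P.vtx (i + k)) := by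
    intro k
    induction k with
    | zero => intro i; simp only [Nat.cast_zero, add_zero]; exact Relation.ReflTransGen.refl
    | succ k ih =>
      intro i
      refine (ih i).tail ?_
      rw [Nat.cast_succ, ← add_assoc]
      exact (P.edge_subset_boundary _).trans P.boundary_subset_region
  have := key (j - i).val i
  rwa [ZMod.natCast_zmod_val, add_sub_cancel] at this

theorem exists_joined_vtx {x : E2} (hx : x ∈ P.region) : ∃ i, P.Joined x (P.vtx i) := by
  have hB : ∀ x ∈ P.boundary, ∃ i, P.Joined x (P.vtx i) := by
    intro x hx
    obtain ⟨i, hi⟩ := mem_iUnion.1 hx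
    exact ⟨i, Relation.ReflTransGen.single <|
      ((convex_segment _ _).segment_subset hi (left_mem_segment ℝ _ _)).trans <|
        (P.edge_subset_boundary i).trans P.boundary_subset_region⟩
  by_cases hxb : x ∈ P.boundary
  · exact hB x hxb
  set v : E2 := !₂[1, 0]
  have hv : v ≠ 0 := fun h => by simpa [v] using congrFun (congrArg WithLp.ofLp h) 0
  have hin : x ∈ P.inner := ⟨hx, hxb⟩
  have hnh : ∀ᶠ t in nhds (0 : ℝ), x + t • v ∈ P.inner := by
    have hc : ContinuousAt (fun t : ℝ => x + t • v) 0 := by fun_prop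
    exact hc.eventually_mem (P.isOpen_inner.mem_nhds (by simpa using hin))
  obtain ⟨δ, hδ, hball⟩ := Metric.eventually_nhds_iff.1 hnh
  obtain ⟨t, ht, htb, hs⟩ := P.exists_first_hit (x := x) hv hδ fun t ht => hball (by
    rw [Real.dist_eq, sub_zero, abs_of_pos ht.1]; exact ht.2)
  obtain ⟨i, hi⟩ := hB _ htb
  refine ⟨i, Relation.ReflTransGen.head ?_ hi⟩
  intro y hy
  rw [segment_eq_image'] at hy
  obtain ⟨s, ⟨hs0, hs1⟩, rfl⟩ := hy
  simp only [add_sub_cancel_left, smul_smul]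
  rcases hs0.eq_or_lt with rfl | hs0
  · simpa using hx
  rcases hs1.eq_or_lt with rfl | hs1
  · simpa using P.boundary_subset_region htb
  · exact (hs (s * t) ⟨by positivity, by nlinarith⟩).1

theorem joined_of_mem {x y : E2} (hx : x ∈ P.region) (hy : y ∈ P.region) : P.Joined x y := by
  obtain ⟨i, hi⟩ := exists_joined_vtx hx
  obtain ⟨j, hj⟩ := exists_joined_vtx hy
  exact hi.trans ((joined_vtx i j).trans hj.symm)

variable (P)

theorem isPreconnected_boundary : IsPreconnected P.boundary := by
  refine IsPreconnected.iUnion_of_reflTransGen (fun i => (convex_segment _ _).isPreconnected) ?_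
  have key : ∀ (k : ℕ) (i : ZMod P.n), Relation.ReflTransGen (fun i j : ZMod P.n =>
      (segment ℝ (P.vtx i) (P.vtx (i + 1)) ∩ segment ℝ (P.vtx j) (P.vtx (j + 1))).Nonempty)
      i (i + k) := by
    intro k
    induction k with
    | zero => intro i; simp only [Nat.cast_zero, add_zero]; exact Relation.ReflTransGen.refl
    | succ k ih =>
      intro i
      refine (ih i).tail ?_
      rw [Nat.cast_succ, ← add_assoc]
      exact ⟨_, right_mem_segment ℝ _ _, left_mem_segment ℝ _ _⟩
  intro i j
  have := key (j - i).val i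
  rwa [ZMod.natCast_zmod_val, add_sub_cancel] at this

end SimplePolygon

namespace SimplePolygon

variable {P : SimplePolygon}

/-! ### Local structure of the boundary curve -/

theorem eq_vtx_of_mem_edges {x : E2} {i j : ZMod P.n} (hij : i ≠ j)
    (hi : x ∈ segment ℝ (P.vtx i) (P.vtx (i + 1))) (hj : x ∈ segment ℝ (P.vtx j) (P.vtx (j + 1))) :
    (j = i + 1 ∧ x = P.vtx j) ∨ (i = j + 1 ∧ x = P.vtx i) := by
  by_cases h1 : i + 1 = j
  · subst h1
    left
    refine ⟨rfl, ?_⟩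
    have := P.adj_edges i
    rw [show i + 2 = i + 1 + 1 by ring] at this
    have h : x ∈ ({P.vtx (i + 1)} : Set E2) := this ▸ ⟨hi, hj⟩
    exact h
  by_cases h2 : j + 1 = i
  · subst h2
    right
    refine ⟨rfl, ?_⟩
    have := P.adj_edges j
    rw [show j + 2 = j + 1 + 1 by ring] at this
    have h : x ∈ ({P.vtx (j + 1)} : Set E2) := this ▸ ⟨hj, hi⟩
    exact h
  · have h : x ∈ (∅ : Set E2) := P.nonadj_edges i j hij h1 h2 ▸ ⟨hi, hj⟩
    exact h.elim

theorem exists_ball_boundary (x : E2) : ∃ r > (0 : ℝ), ∀ y, dist y x < r → y ∈ P.boundary →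
    ∃ i, x ∈ segment ℝ (P.vtx i) (P.vtx (i + 1)) ∧ y ∈ segment ℝ (P.vtx i) (P.vtx (i + 1)) := by
  have hc : IsClosed (⋃ i : {i : ZMod P.n // x ∉ segment ℝ (P.vtx i) (P.vtx (i + 1))},
      segment ℝ (P.vtx i) (P.vtx (i + 1))) := by
    refine isClosed_iUnion_of_finite fun i => IsCompact.isClosed ?_
    rw [segment_eq_image_lineMap]
    exact isCompact_Icc.image AffineMap.lineMap_continuous
  have hx : x ∈ (⋃ i : {i : ZMod P.n // x ∉ segment ℝ (P.vtx i) (P.vtx (i + 1))},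
      segment ℝ (P.vtx i) (P.vtx (i + 1)))ᶜ := by
    simp only [mem_compl_iff, mem_iUnion, not_exists]
    exact fun i => i.2
  obtain ⟨r, hr, hball⟩ := Metric.isOpen_iff.1 hc.isOpen_compl x hx
  refine ⟨r, hr, fun y hy hyb => ?_⟩
  obtain ⟨i, hi⟩ := mem_iUnion.1 hyb
  refine ⟨i, ?_, hi⟩
  by_contra hxi
  exact hball (Metric.mem_ball.2 hy) (mem_iUnion.2 ⟨⟨i, hxi⟩, hi⟩)

theorem vtx_ne_vtx_add_one (i : ZMod P.n) : P.vtx i ≠ P.vtx (i + 1) := fun h => by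
  simpa using P.inj h

/-- Near a boundary point, the boundary curve consists of two distinct rays; they are opposite
unless the point is a vertex. -/
theorem exists_two_rays {x : E2} (hx : x ∈ P.boundary) : ∃ (d₁ d₂ : E2) (r : ℝ),
    0 < r ∧ d₁ ≠ 0 ∧ d₂ ≠ 0 ∧ ¬ OnRay d₁ d₂ ∧
    (∀ v, ‖v‖ < r → (x + v ∈ P.boundary ↔ OnRay d₁ v ∨ OnRay d₂ v)) ∧
    ((∃ i, x = P.vtx i ∧ d₁ = P.vtx (i - 1) - x ∧ d₂ = P.vtx (i + 1) - x) ∨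
      ∀ σ, orientedCross σ d₁ d₂ = 0) := by
  obtain ⟨r, hr, hball⟩ := exists_ball_boundary (P := P) x
  -- It suffices to find the two endpoints of the pieces of the curve through `x`.
  suffices H : ∃ a b : E2, a ≠ x ∧ b ≠ x ∧ ¬ OnRay (a - x) (b - x) ∧
      (∀ y, dist y x < r → (y ∈ P.boundary ↔ y ∈ segment ℝ x a ∨ y ∈ segment ℝ x b)) ∧
      ((∃ i, x = P.vtx i ∧ a - x = P.vtx (i - 1) - x ∧ b - x = P.vtx (i + 1) - x) ∨
        ∀ σ, orientedCross σ (a - x) (b - x) = 0) by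
    obtain ⟨a, b, ha, hb, hab, hy, hv⟩ := H
    have ha' := norm_pos_iff.2 (sub_ne_zero.2 ha)
    have hb' := norm_pos_iff.2 (sub_ne_zero.2 hb)
    refine ⟨a - x, b - x, min r (min ‖a - x‖ ‖b - x‖), by positivity, sub_ne_zero.2 ha,
      sub_ne_zero.2 hb, hab, fun v hvr => ?_, hv⟩
    have key : ∀ c : E2, ‖v‖ < ‖c - x‖ → (x + v ∈ segment ℝ x c ↔ OnRay (c - x) v) := by
      intro c hc
      rw [segment_eq_image']
      constructor
      · rintro ⟨t, ht, h⟩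
        exact ⟨t, ht.1, (add_left_cancel h).symm⟩
      · rintro ⟨t, ht, rfl⟩
        refine ⟨t, ⟨ht, ?_⟩, rfl⟩
        rw [norm_smul, Real.norm_of_nonneg ht] at hc
        by_contra! h1
        nlinarith [norm_nonneg (c - x)]
    rw [hy _ (by simpa using hvr.trans_le (min_le_left _ _)),
      key a (hvr.trans_le ((min_le_right _ _).trans (min_le_left _ _))),
      key b (hvr.trans_le ((min_le_right _ _).trans (min_le_right _ _)))]
  by_cases hvx : ∃ i, x = P.vtx i
  · obtain ⟨i, rfl⟩ := hvx
    have hprev : P.vtx (i - 1) ≠ P.vtx i := by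
      have := vtx_ne_vtx_add_one (i - 1)
      rwa [sub_add_cancel] at this
    have hadj : segment ℝ (P.vtx i) (P.vtx (i - 1)) ∩ segment ℝ (P.vtx i) (P.vtx (i + 1))
        ⊆ {P.vtx i} := by
      have := P.adj_edges (i - 1)
      rw [show i - 1 + 2 = i + 1 by ring, sub_add_cancel] at this
      rw [segment_symm, this]
    refine ⟨P.vtx (i - 1), P.vtx (i + 1), hprev, (vtx_ne_vtx_add_one i).symm, ?_, ?_,
      Or.inl ⟨i, rfl, rfl, rfl⟩⟩
    · rintro ⟨t, ht, h⟩
      rcases le_total t 1 with h1 | h1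
      · refine (vtx_ne_vtx_add_one i).symm (hadj ⟨?_, right_mem_segment ℝ _ _⟩)
        rw [segment_eq_image']
        refine ⟨t, ⟨ht, h1⟩, ?_⟩
        simp only
        rw [← h, add_sub_cancel]
      · refine hprev (hadj ⟨right_mem_segment ℝ _ _, ?_⟩)
        rw [segment_eq_image']
        refine ⟨t⁻¹, ⟨by positivity, inv_le_one_of_one_le₀ h1⟩, ?_⟩
        simp only
        rw [h, smul_smul, inv_mul_cancel₀ (by linarith), one_smul, add_sub_cancel]
    · intro y hy
      constructor
      · intro hyb
        obtain ⟨j, hj1, hj2⟩ := hball y hy hyb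
        by_cases hij : i = j
        · subst hij; exact Or.inr hj2
        · rcases eq_vtx_of_mem_edges hij (left_mem_segment ℝ _ _) hj1 with ⟨h1, h2⟩ | ⟨h1, -⟩
          · exact (vtx_ne_vtx_add_one i (h1 ▸ h2)).elim
          · subst h1
            left
            rw [add_sub_cancel_right, segment_symm]
            exact hj2
      · rintro (h | h)
        · rw [segment_symm] at h
          have := P.edge_subset_boundary (i - 1)
          rw [sub_add_cancel] at this
          exact this h
        · exact P.edge_subset_boundary i h
  · push Not at hvx
    obtain ⟨i, hi⟩ := mem_iUnion.1 hx
    have honly : ∀ j, x ∈ segment ℝ (P.vtx j) (P.vtx (j + 1)) → j = i := by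
      intro j hj
      by_contra hne
      rcases eq_vtx_of_mem_edges hne hj hi with ⟨-, h⟩ | ⟨-, h⟩
      · exact hvx _ h
      · exact hvx _ h
    have hi' := hi
    rw [segment_eq_image'] at hi
    obtain ⟨t, ⟨ht0, ht1⟩, hxt⟩ := hi
    simp only at hxt
    set A := P.vtx i
    set B := P.vtx (i + 1)
    have hAB : B - A ≠ 0 := sub_ne_zero.2 (vtx_ne_vtx_add_one i).symm
    have hA : A - x = -(t • (B - A)) := by rw [← hxt]; abel
    have hB : B - x = (1 - t) • (B - A) := by rw [← hxt, sub_smul, one_smul]; abel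
    have ht0' : 0 < t := ht0.lt_of_ne (by rintro rfl; apply hvx i; rw [← hxt]; simp [A])
    have ht1' : t < 1 := ht1.lt_of_ne (by
      rintro rfl; apply hvx (i + 1); rw [← hxt, one_smul, add_sub_cancel])
    refine ⟨A, B, (hvx i).symm, (hvx (i + 1)).symm, ?_, ?_, Or.inr ?_⟩
    · rintro ⟨s, hs, h⟩
      rw [hA, hB, ← sub_eq_zero, smul_neg, sub_neg_eq_add, smul_smul, ← add_smul,
        smul_eq_zero] at h
      rcases h with h | h
      · nlinarith
      · exact hAB h
    · intro y hy
      have hseg : y ∈ segment ℝ A B ↔ y ∈ segment ℝ x A ∨ y ∈ segment ℝ x B := by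
        constructor
        · rw [segment_eq_image', segment_eq_image', segment_eq_image']
          rintro ⟨s, ⟨hs0, hs1⟩, rfl⟩
          rcases le_total s t with h | h
          · left
            refine ⟨1 - s / t, ⟨?_, ?_⟩, ?_⟩
            · rw [sub_nonneg]; exact (div_le_one ht0').2 h
            · have : 0 ≤ s / t := by positivity
              linarith
            · simp only
              rw [hA, ← hxt, smul_neg, smul_smul, sub_mul, one_mul,
                div_mul_cancel₀ _ ht0'.ne', sub_smul]
              abel
          · right
            refine ⟨(s - t) / (1 - t), ⟨div_nonneg (by linarith) (by linarith),
              (div_le_one (by linarith)).2 (by linarith)⟩, ?_⟩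
            simp only
            rw [hB, smul_smul, div_mul_cancel₀ _ (by linarith), ← hxt, sub_smul]
            abel
        · rintro (h | h)
          · exact (convex_segment _ _).segment_subset hi' (left_mem_segment ℝ _ _) h
          · exact (convex_segment _ _).segment_subset hi' (right_mem_segment ℝ _ _) h
      rw [← hseg]
      constructor
      · intro hyb
        obtain ⟨j, hj1, hj2⟩ := hball y hy hyb
        rw [honly j hj1] at hj2
        exact hj2
      · exact fun h => P.edge_subset_boundary i h
    · intro σ
      rw [hA, hB, orientedCross_smul_right, orientedCross_neg_left, orientedCross_smul_left,
        orientedCross_self]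
      ring

/-! ### Inside and outside near the boundary -/

/-- A set disjoint from the boundary curve that contains every connected set off the curve which
it meets accumulates at every boundary point as soon as it accumulates at one. -/
theorem boundary_subset_closure {X : Set E2}
    (hX : ∀ S : Set E2, IsPreconnected S → S ⊆ P.boundaryᶜ → (S ∩ X).Nonempty → S ⊆ X)
    (hd : Disjoint X P.boundary) (hne : (P.boundary ∩ closure X).Nonempty) :
    P.boundary ⊆ closure X := by
  have hloc : ∀ x ∈ P.boundary ∩ closure X, ∃ r > (0 : ℝ), ∀ y ∈ P.boundary,
      dist y x < r → y ∈ closure X := by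
    rintro x ⟨hx, hxX⟩
    obtain ⟨d₁, d₂, r, hr, h1, h2, h12, hray, -⟩ := exists_two_rays hx
    refine ⟨r, hr, ?_⟩
    have key : ∀ a b : E2, a ≠ 0 → b ≠ 0 → ¬ OnRay a b →
        (∀ v, ‖v‖ < r → (x + v ∈ P.boundary ↔ OnRay a v ∨ OnRay b v)) →
        (∃ v, ‖v‖ < r ∧ x + v ∈ X ∧ InSector 1 a b v) →
        ∀ y ∈ P.boundary, dist y x < r → y ∈ closure X := by
      rintro a b ha hb hab hray ⟨v, hv, hvX, hvs⟩ y hyb hyr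
      have hpre := (isPreconnected_inSector_inter_ball one_ne_zero ha hb hab hr).image
        (fun v => x + v) (by fun_prop)
      have hsub := hX _ hpre (by
        rintro _ ⟨w, ⟨hw, hwr⟩, rfl⟩ hwb
        have := not_onRay_of_inSector hw
        have := (hray w (by simpa using hwr)).1 hwb
        tauto) ⟨x + v, ⟨v, ⟨hvs, by simpa using hv⟩, rfl⟩, hvX⟩
      obtain ⟨g, hg⟩ := exists_inSector_add one_ne_zero ha hb hab
      have hy : y = x + (y - x) := by abel
      have hyr' : ‖y - x‖ < r := by rwa [← dist_eq_norm]
      have hsec : ∀ ε > (0 : ℝ), InSector 1 a b (y - x + ε • g) := by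
        intro ε hε
        rcases (hray (y - x) hyr').1 (by rwa [← hy]) with ⟨t, ht, h⟩ | ⟨t, ht, h⟩
        · rw [h]; exact (hg t ht ε hε).1
        · rw [h]; exact (hg t ht ε hε).2
      have hlim : Filter.Tendsto (fun ε : ℝ => x + (y - x + ε • g)) (nhdsWithin 0 (Ioi 0))
          (nhds y) := by
        have : Continuous (fun ε : ℝ => x + (y - x + ε • g)) := by fun_prop
        have := this.tendsto 0
        simp only [zero_smul, add_zero, add_sub_cancel] at this
        exact this.mono_left nhdsWithin_le_nhds
      refine mem_closure_of_tendsto hlim ?_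
      have hn : ∀ᶠ ε in nhdsWithin (0 : ℝ) (Ioi 0), ‖y - x + ε • g‖ < r := by
        have : Continuous (fun ε : ℝ => ‖y - x + ε • g‖) := by fun_prop
        have := this.tendsto 0
        simp only [zero_smul, add_zero] at this
        exact (this.mono_left nhdsWithin_le_nhds).eventually_lt_const hyr'
      filter_upwards [hn, self_mem_nhdsWithin] with ε hε hε0
      exact hsub ⟨_, ⟨hsec ε hε0, by simpa using hε⟩, rfl⟩
    obtain ⟨w, hwX, hwr⟩ := Metric.mem_closure_iff.1 hxX r hr
    have hw : w = x + (w - x) := by abel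
    have hwr' : ‖w - x‖ < r := by rwa [← dist_eq_norm, dist_comm]
    have hwb : ¬ (OnRay d₁ (w - x) ∨ OnRay d₂ (w - x)) := by
      rw [← hray _ hwr', ← hw]
      exact disjoint_left.1 hd hwX
    have h21 : ¬ OnRay d₂ d₁ := by
      rintro ⟨t, ht, h⟩
      have ht0 : t ≠ 0 := by rintro rfl; simp at h; exact h1 h
      exact h12 ⟨t⁻¹, by positivity, by rw [h, smul_smul, inv_mul_cancel₀ ht0, one_smul]⟩
    rcases inSector_or_onRay one_ne_zero h1 h2 h12 (w - x) with h | h | h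
    · exact key d₁ d₂ h1 h2 h12 hray ⟨w - x, hwr', by rwa [← hw], h⟩
    · exact key d₂ d₁ h2 h1 h21 (fun v hv => by rw [hray v hv, or_comm])
        ⟨w - x, hwr', by rwa [← hw], h⟩
    · exact (hwb h).elim
  by_contra hcon
  obtain ⟨y, hyb, hy⟩ := not_subset.1 hcon
  choose! r hr hrr using hloc
  obtain ⟨z, hzb, hz1, hz2⟩ := P.isPreconnected_boundary
    (⋃ x ∈ P.boundary ∩ closure X, Metric.ball x (r x)) (closure X)ᶜ
    (isOpen_biUnion fun _ _ => Metric.isOpen_ball) isClosed_closure.isOpen_compl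
    (by
      intro z hz
      by_cases h : z ∈ closure X
      · exact Or.inl (mem_biUnion (⟨hz, h⟩ : z ∈ P.boundary ∩ closure X)
          (Metric.mem_ball_self (hr z ⟨hz, h⟩)))
      · exact Or.inr h)
    (by
      obtain ⟨x, hx⟩ := hne
      exact ⟨x, hx.1, mem_biUnion hx (Metric.mem_ball_self (hr x hx))⟩)
    ⟨y, hyb, hy⟩
  obtain ⟨x, hx, hzx⟩ := mem_iUnion₂.1 hz1
  exact hz2 (hrr x hx z hzb hzx)

theorem boundary_subset_closure_compl : P.boundary ⊆ closure P.regionᶜ := by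
  refine boundary_subset_closure (fun S hS hd ⟨x, hx, hxX⟩ => compl_of_preconnected hS hd hx hxX)
    (disjoint_left.2 fun x hx hxb => hx (P.boundary_subset_region hxb)) ?_
  obtain ⟨x, hx⟩ : (frontier P.region).Nonempty := by
    refine nonempty_frontier_iff.2 ⟨⟨_, P.boundary_subset_region (P.vtx_mem_boundary 0)⟩, ?_⟩
    intro h
    have := P.isBounded_region
    rw [h] at this
    exact (NormedSpace.noncompactSpace ℝ E2).noncompact_univ
      (Metric.isCompact_of_isClosed_isBounded isClosed_univ this)
  rw [frontier_eq_closure_inter_closure, P.isClosed_region.closure_eq] at hx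
  refine ⟨x, ?_, hx.2⟩
  by_contra hxb
  exact closure_minimal (fun y hy hyi => hy hyi.1 : P.regionᶜ ⊆ P.innerᶜ)
    P.isOpen_inner.isClosed_compl hx.2 ⟨hx.1, hxb⟩

theorem boundary_subset_closure_inner (hP : P.inner.Nonempty) :
    P.boundary ⊆ closure P.inner := by
  refine boundary_subset_closure
    (fun S hS hd ⟨x, hx, hxX⟩ => inner_of_preconnected hS hd hx hxX.1)
    (disjoint_left.2 fun x hx hxb => hx.2 hxb) ?_
  obtain ⟨x, hx⟩ : (frontier P.inner).Nonempty := by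
    refine nonempty_frontier_iff.2 ⟨hP, ?_⟩
    intro h
    have := h ▸ mem_univ (P.vtx 0)
    exact this.2 (P.vtx_mem_boundary 0)
  rw [P.isOpen_inner.frontier_eq] at hx
  refine ⟨x, ?_, hx.1⟩
  by_contra hxb
  exact hx.2 ⟨closure_minimal (fun y hy => hy.1) P.isClosed_region hx.1, hxb⟩

/-- Local picture at a boundary point `x`: the curve consists of the rays `d₁`, `d₂`; the sector
from `d₁` to `d₂` is inside the polygon and the sector from `d₂` to `d₁` is outside. -/
structure LocalCone (P : SimplePolygon) (σ : ℝ) (x d₁ d₂ : E2) (r : ℝ) : Prop where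
  pos : 0 < r
  ne₁ : d₁ ≠ 0
  ne₂ : d₂ ≠ 0
  not_onRay : ¬ OnRay d₁ d₂
  boundary_iff : ∀ v, ‖v‖ < r → (x + v ∈ P.boundary ↔ OnRay d₁ v ∨ OnRay d₂ v)
  inner_of : ∀ v, ‖v‖ < r → InSector σ d₁ d₂ v → x + v ∈ P.inner
  outer_of : ∀ v, ‖v‖ < r → InSector σ d₂ d₁ v → x + v ∉ P.region
  vertex : (∃ i, x = P.vtx i ∧ ((d₁ = P.vtx (i - 1) - x ∧ d₂ = P.vtx (i + 1) - x) ∨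
      (d₁ = P.vtx (i + 1) - x ∧ d₂ = P.vtx (i - 1) - x))) ∨ orientedCross σ d₁ d₂ = 0

theorem exists_localCone (hP : P.inner.Nonempty) {σ : ℝ} (hσ : σ ≠ 0) {x : E2}
    (hx : x ∈ P.boundary) : ∃ d₁ d₂ r, P.LocalCone σ x d₁ d₂ r := by
  obtain ⟨d₁, d₂, r, hr, h1, h2, h12, hray, hv⟩ := exists_two_rays hx
  have h21 : ¬ OnRay d₂ d₁ := by
    rintro ⟨t, ht, h⟩
    have ht0 : t ≠ 0 := by rintro rfl; simp at h; exact h1 h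
    exact h12 ⟨t⁻¹, by positivity, by rw [h, smul_smul, inv_mul_cancel₀ ht0, one_smul]⟩
  have hoff : ∀ v, ‖v‖ < r → ¬ OnRay d₁ v → ¬ OnRay d₂ v → x + v ∉ P.boundary := by
    intro v hv h3 h4 h
    rcases (hray v hv).1 h with h | h <;> contradiction
  have hconst : ∀ a b : E2, a ≠ 0 → b ≠ 0 → ¬ OnRay a b →
      (∀ v, ‖v‖ < r → (x + v ∈ P.boundary ↔ OnRay a v ∨ OnRay b v)) →
      ∀ v w, ‖v‖ < r → InSector σ a b v → ‖w‖ < r → InSector σ a b w →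
        (x + v ∈ P.region ↔ x + w ∈ P.region) := by
    intro a b ha hb hab hray v w hv hvs hw hws
    refine mem_region_iff_of_preconnected
      ((isPreconnected_inSector_inter_ball hσ ha hb hab hr).image (fun v => x + v) (by fun_prop))
      ?_ ⟨v, ⟨hvs, by simpa using hv⟩, rfl⟩ ⟨w, ⟨hws, by simpa using hw⟩, rfl⟩
    rintro _ ⟨w, ⟨hw, hwr⟩, rfl⟩ hwb
    have := not_onRay_of_inSector hw
    have := (hray w (by simpa using hwr)).1 hwb
    tauto
  have hray' : ∀ v, ‖v‖ < r → (x + v ∈ P.boundary ↔ OnRay d₂ v ∨ OnRay d₁ v) :=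
    fun v hv => by rw [hray v hv, or_comm]
  have hc1 := hconst d₁ d₂ h1 h2 h12 hray
  have hc2 := hconst d₂ d₁ h2 h1 h21 hray'
  obtain ⟨v, hvr, hvo⟩ : ∃ v, ‖v‖ < r ∧ x + v ∉ P.region := by
    obtain ⟨w, hw, hwr⟩ := Metric.mem_closure_iff.1 (boundary_subset_closure_compl hx) r hr
    exact ⟨w - x, by rwa [← dist_eq_norm, dist_comm], by rwa [add_sub_cancel]⟩
  obtain ⟨w, hwr, hwi⟩ : ∃ v, ‖v‖ < r ∧ x + v ∈ P.inner := by
    obtain ⟨w, hw, hwr⟩ := Metric.mem_closure_iff.1 (boundary_subset_closure_inner hP hx) r hr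
    exact ⟨w - x, by rwa [← dist_eq_norm, dist_comm], by rwa [add_sub_cancel]⟩
  have hvb : x + v ∉ P.boundary := fun h => hvo (P.boundary_subset_region h)
  rw [hray v hvr] at hvb
  have hwb := hwi.2
  rw [hray w hwr] at hwb
  have hv' : InSector σ d₁ d₂ v ∨ InSector σ d₂ d₁ v := by
    have := inSector_or_onRay hσ h1 h2 h12 v; tauto
  have hw' : InSector σ d₁ d₂ w ∨ InSector σ d₂ d₁ w := by
    have := inSector_or_onRay hσ h1 h2 h12 w; tauto
  rcases hv' with hv' | hv'
  · have hw'' : InSector σ d₂ d₁ w := hw'.resolve_left fun h =>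
      hvo ((hc1 v w hvr hv' hwr h).2 hwi.1)
    refine ⟨d₂, d₁, r, hr, h2, h1, h21, hray', fun y hy hys => ⟨(hc2 w y hwr hw'' hy hys).1 hwi.1, ?_⟩,
      fun y hy hys h => hvo ((hc1 v y hvr hv' hy hys).2 h), ?_⟩
    · have := not_onRay_of_inSector hys
      exact hoff y hy this.2 this.1
    · rcases hv with ⟨i, h⟩ | h
      · exact Or.inl ⟨i, h.1, Or.inr ⟨h.2.2, h.2.1⟩⟩
      · exact Or.inr (by rw [orientedCross_swap, h, neg_zero])
  · have hw'' : InSector σ d₁ d₂ w := hw'.resolve_right fun h =>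
      hvo ((hc2 v w hvr hv' hwr h).2 hwi.1)
    refine ⟨d₁, d₂, r, hr, h1, h2, h12, hray, fun y hy hys => ⟨(hc1 w y hwr hw'' hy hys).1 hwi.1, ?_⟩,
      fun y hy hys h => hvo ((hc2 v y hvr hv' hy hys).2 h), ?_⟩
    · have := not_onRay_of_inSector hys
      exact hoff y hy this.1 this.2
    · rcases hv with ⟨i, h⟩ | h
      · exact Or.inl ⟨i, h.1, Or.inl h.2⟩
      · exact Or.inr (h σ)

/-- The boundary has empty interior. -/
theorem exists_mem_not_boundary {U : Set E2} (hU : IsOpen U) (hne : U.Nonempty) :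
    ∃ x ∈ U, x ∉ P.boundary := by
  obtain ⟨x, hx⟩ := hne
  by_cases hxb : x ∈ P.boundary
  · exact (mem_closure_iff.1 (boundary_subset_closure_compl hxb) U hU hx).imp fun y hy =>
      ⟨hy.1, fun h => hy.2 (P.boundary_subset_region h)⟩
  · exact ⟨x, hx, hxb⟩

end SimplePolygon

/-- The plane identified with `ℂ`. -/
def toComplex : E2 ≃ₗᵢ[ℝ] ℂ := Complex.orthonormalBasisOneI.repr.symm

theorem toComplex_apply (z : E2) : toComplex z = z 0 + z 1 * Complex.I :=
  Complex.orthonormalBasisOneI_repr_symm_apply z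

/-- There is a continuous branch of the logarithm of `z - a` on `A`. -/
def HasLog (A : Set E2) (a : E2) : Prop :=
  ∃ L : E2 → ℂ, ContinuousOn L A ∧ ∀ z ∈ A, Complex.exp (L z) = toComplex (z - a)

theorem mem_segment_of_div_notMem_slitPlane {a b z : E2} (hzb : z ≠ b)
    (h : toComplex (z - a) / toComplex (z - b) ∉ Complex.slitPlane) : z ∈ segment ℝ a b := by
  rw [Complex.mem_slitPlane_iff] at h
  push Not at h
  set w := toComplex (z - a) / toComplex (z - b) with hw
  have hb : toComplex (z - b) ≠ 0 := by simpa [sub_eq_zero] using hzb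
  have h1 : toComplex (z - a) = toComplex (w.re • (z - b)) := by
    rw [map_smul, Complex.real_smul]
    have : ((w.re : ℝ) : ℂ) = w := Complex.ext (by simp) (by simp [h.2])
    rw [this, hw, div_mul_cancel₀ _ hb]
  have h2 : z - a = w.re • (z - b) := toComplex.injective h1
  have h3 : (0 : ℝ) < 1 - w.re := by linarith [h.1]
  refine ⟨1 / (1 - w.re), -w.re / (1 - w.re), by positivity,
    div_nonneg (by linarith [h.1]) h3.le, by field_simp; ring, ?_⟩
  have : (1 - w.re) • z = a + (-w.re) • b := by
    have : z = a + w.re • (z - b) := by rw [← h2]; abel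
    rw [sub_smul, one_smul]; nth_rewrite 1 [this]; module
  rw [div_eq_inv_mul, div_eq_inv_mul, mul_one, ← smul_smul, ← smul_add, ← this, smul_smul,
    inv_mul_cancel₀ h3.ne', one_smul]

theorem continuousOn_log_div {a b : E2} {A : Set E2} (h : Disjoint (segment ℝ a b) A) :
    ContinuousOn (fun z => Complex.log (toComplex (z - a) / toComplex (z - b))) A := by
  have hne : ∀ z ∈ A, z ≠ b := fun z hz e =>
    h.ne_of_mem (right_mem_segment ℝ a b) hz e.symm
  refine ContinuousOn.clog (ContinuousOn.div ?_ ?_ ?_) ?_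
  · exact (toComplex.continuous.comp (continuous_sub_right a)).continuousOn
  · exact (toComplex.continuous.comp (continuous_sub_right b)).continuousOn
  · intro z hz
    simpa [sub_eq_zero] using hne z hz
  · intro z hz
    by_contra hc
    exact h.ne_of_mem (mem_segment_of_div_notMem_slitPlane (hne z hz) hc) hz rfl

theorem exp_log_div {a b z : E2} (ha : z ≠ a) (hb : z ≠ b) :
    Complex.exp (Complex.log (toComplex (z - a) / toComplex (z - b))) =
      toComplex (z - a) / toComplex (z - b) := by
  rw [Complex.exp_log]
  exact div_ne_zero (by simpa [sub_eq_zero] using ha) (by simpa [sub_eq_zero] using hb)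

theorem HasLog.of_segment {A : Set E2} {a b : E2} (hL : HasLog A a)
    (h : Disjoint (segment ℝ b a) A) : HasLog A b := by
  obtain ⟨L, hc, he⟩ := hL
  refine ⟨_, hc.add (continuousOn_log_div h), fun z hz => ?_⟩
  have ha : z ≠ a := fun e => h.ne_of_mem (right_mem_segment ℝ b a) hz e.symm
  have hb : z ≠ b := fun e => h.ne_of_mem (left_mem_segment ℝ b a) hz e.symm
  have h0 : toComplex (z - a) ≠ 0 := by simpa [sub_eq_zero] using ha
  rw [Pi.add_apply, Complex.exp_add, he z hz, exp_log_div hb ha, mul_div_cancel₀ _ h0]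

theorem HasLog.mono {A B : Set E2} {a : E2} (hL : HasLog A a) (h : B ⊆ A) : HasLog B a :=
  hL.imp fun _ hL => ⟨hL.1.mono h, fun z hz => hL.2 z (h hz)⟩

theorem hasLog_of_norm_lt {A : Set E2} {a : E2} (h : ∀ z ∈ A, ‖z‖ < ‖a‖) : HasLog A a := by
  rcases A.eq_empty_or_nonempty with rfl | ⟨z₀, hz₀⟩
  · exact ⟨0, by simp, by simp⟩
  have ha : toComplex a ≠ 0 := by
    have := (norm_nonneg z₀).trans_lt (h z₀ hz₀)
    simpa using this
  have hre : ∀ z ∈ A, 0 < (1 - toComplex z / toComplex a).re := by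
    intro z hz
    have h1 : ‖toComplex z / toComplex a‖ < 1 := by
      rw [norm_div, toComplex.norm_map, toComplex.norm_map]
      exact (div_lt_one ((norm_nonneg z).trans_lt (h z hz))).2 (h z hz)
    have := (Complex.re_le_norm _).trans_lt h1
    simpa using this
  refine ⟨fun z => Complex.log (-toComplex a) + Complex.log (1 - toComplex z / toComplex a),
    ContinuousOn.add continuousOn_const (ContinuousOn.clog ?_ fun z hz => Or.inl (hre z hz)), ?_⟩
  · exact (continuous_const.sub (toComplex.continuous.div_const _)).continuousOn
  · intro z hz
    rw [Complex.exp_add, Complex.exp_log (neg_ne_zero.2 ha), Complex.exp_log, map_sub]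
    · field_simp
      ring
    · intro h0
      have := hre z hz
      rw [h0] at this
      simp at this

namespace SimplePolygon

variable {P : SimplePolygon}

theorem hasLog_of_notMem {a : E2} (ha : a ∉ P.region) : HasLog P.region a := by
  have hab : a ∉ P.boundary := fun h => ha (P.boundary_subset_region h)
  set S := connectedComponentIn P.boundaryᶜ a
  have haS : a ∈ S := mem_connectedComponentIn hab
  have hSp : IsPreconnected S := isPreconnected_connectedComponentIn
  have hSb : ¬ Bornology.IsBounded S := fun h => ha (Or.inr ⟨hab, h⟩)
  have hSo : ∀ x ∈ S, x ∉ P.region := fun x hx => compl_of_preconnected hSp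
    (fun y hy => connectedComponentIn_subset _ _ hy) haS ha hx
  have hball : ∀ x ∉ P.region, ∃ r > 0, ∀ y, dist y x < r →
      Disjoint (segment ℝ x y) P.region := by
    intro x hx
    obtain ⟨r, hr, h⟩ := Metric.isOpen_iff.1 P.isClosed_region.isOpen_compl x hx
    refine ⟨r, hr, fun y hy => disjoint_left.2 fun z hz => h ?_⟩
    exact (convex_ball x r).segment_subset (Metric.mem_ball_self hr) hy hz
  have hsub : S ⊆ {x | x ∉ P.region ∧ HasLog P.region x} := by
    refine hSp.subset_of_closure_inter_subset ?_ ?_ ?_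
    · refine Metric.isOpen_iff.2 fun x hx => ?_
      obtain ⟨r, hr, h⟩ := hball x hx.1
      refine ⟨r, hr, fun y hy => ?_⟩
      have := h y hy
      refine ⟨fun hyr => this.ne_of_mem (right_mem_segment ℝ x y) hyr rfl, ?_⟩
      exact hx.2.of_segment (by rwa [segment_symm])
    · obtain ⟨R, hR⟩ := P.isBounded_region.exists_norm_le
      obtain ⟨x, hx, hxR⟩ : ∃ x ∈ S, R < ‖x‖ := by
        by_contra! hc
        exact hSb (isBounded_iff_forall_norm_le.2 ⟨R, hc⟩)
      exact ⟨x, hx, hSo x hx, hasLog_of_norm_lt fun z hz => (hR z hz).trans_lt hxR⟩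
    · rintro x ⟨hxc, hxS⟩
      obtain ⟨r, hr, h⟩ := hball x (hSo x hxS)
      obtain ⟨y, hy, hyx⟩ := Metric.mem_closure_iff.1 hxc r hr
      exact ⟨hSo x hxS, hy.2.of_segment (h y (by rwa [dist_comm]))⟩
  exact (hsub haS).2

/-- Boundary points are accessible from outside. -/
theorem exists_segment_outside (hP : P.inner.Nonempty) {a : E2} (ha : a ∈ P.boundary) :
    ∃ b, b ∉ P.region ∧ Disjoint (segment ℝ a b) (P.region \ {a}) := by
  obtain ⟨d₁, d₂, r, hc⟩ := exists_localCone hP one_ne_zero ha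
  obtain ⟨w, hw, hwr⟩ := Metric.mem_closure_iff.1 (boundary_subset_closure_compl ha) r hc.pos
  have hwn : ‖w - a‖ < r := by rwa [← dist_eq_norm, dist_comm]
  have hwb : a + (w - a) ∉ P.boundary := by
    rw [add_sub_cancel]; exact fun h => hw (P.boundary_subset_region h)
  have hws : InSector 1 d₂ d₁ (w - a) := by
    rw [hc.boundary_iff _ hwn] at hwb
    rcases inSector_or_onRay one_ne_zero hc.ne₁ hc.ne₂ hc.not_onRay (w - a) with h | h | h
    · exact absurd (hc.inner_of _ hwn h).1 (by rwa [add_sub_cancel])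
    · exact h
    · exact absurd h hwb
  refine ⟨w, hw, disjoint_left.2 ?_⟩
  rw [segment_eq_image']
  rintro _ ⟨t, ⟨h0, h1⟩, rfl⟩ ⟨hz, hza⟩
  rcases h0.eq_or_lt with rfl | h0
  · simp at hza
  · refine hc.outer_of _ ?_ (hws.smul h0) hz
    rw [norm_smul, Real.norm_of_nonneg h0.le]
    nlinarith [norm_nonneg (w - a)]

theorem hasLog_of_boundary (hP : P.inner.Nonempty) {a : E2} (ha : a ∈ P.boundary) :
    HasLog (P.region \ {a}) a := by
  obtain ⟨b, hb, hd⟩ := exists_segment_outside hP ha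
  exact ((hasLog_of_notMem hb).mono sdiff_subset).of_segment hd

open Filter Topology in
/-- A chord of the polygon separates its two sides. -/
theorem chord_separates (hP : P.inner.Nonempty) {x b m : E2} (hx : x ∈ P.boundary)
    (hb : b ∈ P.boundary) (hxb : x ≠ b) (hm : m ∈ openSegment ℝ x b) {K : Set E2}
    (hK : IsPreconnected K) (hKP : K ⊆ P.region) (hKs : Disjoint (segment ℝ x b) K)
    (hl : m ∈ closure (K ∩ {z | 0 < cross2 (b - x) (z - x)}))
    (hr : m ∈ closure (K ∩ {z | cross2 (b - x) (z - x) < 0})) : False := by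
  obtain ⟨Lx, hLxc, hLx⟩ := hasLog_of_boundary hP hx
  obtain ⟨Lb, hLbc, hLb⟩ := hasLog_of_boundary hP hb
  set w : E2 → ℂ := fun z => toComplex (z - x) / toComplex (z - b) with hw
  have hmP : m ∈ P.region := closure_minimal (inter_subset_left.trans hKP) P.isClosed_region hl
  have hmx : m ≠ x := fun h => hxb ((left_mem_openSegment_iff).1 (h ▸ hm))
  have hmb : m ≠ b := fun h => hxb ((right_mem_openSegment_iff).1 (h ▸ hm))
  have hKx : K ⊆ P.region \ {x} := fun z hz =>
    ⟨hKP hz, fun e => hKs.ne_of_mem (left_mem_segment ℝ x b) hz (Eq.symm e)⟩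
  have hKb : K ⊆ P.region \ {b} := fun z hz =>
    ⟨hKP hz, fun e => hKs.ne_of_mem (right_mem_segment ℝ x b) hz (Eq.symm e)⟩
  have hMc : ContinuousOn (fun z => Lx z - Lb z - Complex.log (w z)) K :=
    ((hLxc.mono hKx).sub (hLbc.mono hKb)).sub (continuousOn_log_div hKs)
  have hMe : ∀ z ∈ K, Complex.exp (Lx z - Lb z - Complex.log (w z)) = 1 := by
    intro z hz
    have h1 : z ≠ x := (hKx hz).2
    have h2 : z ≠ b := (hKb hz).2
    have h3 : toComplex (z - x) / toComplex (z - b) ≠ 0 :=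
      div_ne_zero (by simpa [sub_eq_zero] using h1) (by simpa [sub_eq_zero] using h2)
    rw [Complex.exp_sub, Complex.exp_sub, hLx z (hKx hz), hLb z (hKb hz), exp_log_div h1 h2,
      div_self h3]
  have hsub : ((fun z => Lx z - Lb z - Complex.log (w z)) '' K).Subsingleton := by
    refine (Complex.countable_preimage_exp.2 (countable_singleton (1 : ℂ))).isTotallyDisconnected
      _ ?_ (hK.image _ hMc)
    rintro _ ⟨z, hz, rfl⟩
    exact hMe z hz
  obtain ⟨z₀, hz₀⟩ : K.Nonempty := by
    obtain ⟨z, hz⟩ := closure_nonempty_iff.1 ⟨m, hl⟩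
    exact ⟨z, hz.1⟩
  have hconst : ∀ z ∈ K, Lx z - Lb z - Complex.log (w z) =
      Lx z₀ - Lb z₀ - Complex.log (w z₀) := fun z hz =>
    hsub ⟨z, hz, rfl⟩ ⟨z₀, hz₀, rfl⟩
  set k := Lx z₀ - Lb z₀ - Complex.log (w z₀)
  have hwc : ContinuousAt w m := by
    refine ContinuousAt.div ?_ ?_ (by simpa [sub_eq_zero] using hmb)
    · exact (toComplex.continuous.comp (continuous_sub_right x)).continuousAt
    · exact (toComplex.continuous.comp (continuous_sub_right b)).continuousAt
  have him : ∀ z ≠ b, (w z).im = -cross2 (b - x) (z - x) / Complex.normSq (toComplex (z - b)) := by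
    intro z _
    rw [hw]
    simp only [Complex.div_im, toComplex_apply, cross2]
    simp
    ring
  have hlog : ∀ T : Set E2, ∀ c : ℂ, m ∈ closure (K ∩ T) →
      Tendsto (fun z => Complex.log (w z)) (𝓝[K ∩ T] m) (𝓝 c) → Lx m - Lb m - c = k := by
    intro T c hT hc
    have : (𝓝[K ∩ T] m).NeBot := mem_closure_iff_nhdsWithin_neBot.1 hT
    have h1 : Tendsto Lx (𝓝[K ∩ T] m) (𝓝 (Lx m)) :=
      (hLxc m ⟨hmP, hmx⟩).mono_left (nhdsWithin_mono _ (inter_subset_left.trans hKx))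
    have h2 : Tendsto Lb (𝓝[K ∩ T] m) (𝓝 (Lb m)) :=
      (hLbc m ⟨hmP, hmb⟩).mono_left (nhdsWithin_mono _ (inter_subset_left.trans hKb))
    refine tendsto_nhds_unique ((h1.sub h2).sub hc) (tendsto_const_nhds.congr' ?_)
    filter_upwards [self_mem_nhdsWithin] with z hz
    exact (hconst z hz.1).symm
  obtain ⟨α, β, hα, hβ, hαβ, rfl⟩ := hm
  have hwm : w (α • x + β • b) = ((-(β / α) : ℝ) : ℂ) := by
    have h1 : α • x + β • b - x = β • (b - x) := by
      rw [show α = 1 - β by linarith]; module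
    have h2 : α • x + β • b - b = (-α) • (b - x) := by
      rw [show β = 1 - α by linarith]; module
    have h3 : toComplex (b - x) ≠ 0 := by simpa [sub_eq_zero] using hxb.symm
    simp only [hw]
    rw [h1, h2, map_smul, map_smul, Complex.real_smul, Complex.real_smul, mul_div_mul_right _ _ h3]
    push_cast
    rw [div_neg]
  have hre : (w (α • x + β • b)).re < 0 := by
    rw [hwm, Complex.ofReal_re]; have := div_pos hβ hα; linarith
  have him0 : (w (α • x + β • b)).im = 0 := by rw [hwm, Complex.ofReal_im]
  have hsq : ∀ z ∈ K, 0 < Complex.normSq (toComplex (z - b)) := fun z hz =>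
    Complex.normSq_pos.2 (by simpa [sub_eq_zero] using (hKb hz).2)
  have e1 := hlog _ _ hl ((Complex.tendsto_log_nhdsWithin_im_neg_of_re_neg_of_im_zero hre
    him0).comp (tendsto_nhdsWithin_iff.2 ⟨hwc.continuousWithinAt, by
      filter_upwards [self_mem_nhdsWithin] with z hz
      rw [him z (hKb hz.1).2]
      exact div_neg_of_neg_of_pos (neg_lt_zero.2 hz.2) (hsq z hz.1)⟩))
  have e2 := hlog _ _ hr ((Complex.tendsto_log_nhdsWithin_im_nonneg_of_re_neg_of_im_zero hre
    him0).comp (tendsto_nhdsWithin_iff.2 ⟨hwc.continuousWithinAt, by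
      filter_upwards [self_mem_nhdsWithin] with z hz
      rw [him z (hKb hz.1).2]
      exact div_nonneg (neg_nonneg.2 (le_of_lt hz.2)) (hsq z hz.1).le⟩))
  have e3 := e1.trans e2.symm
  have := congrArg Complex.im e3
  simp at this
  linarith [Real.pi_pos]

theorem isClosed_setOf_visible (u : E2) : IsClosed {y | P.Visible u y} := by
  have : {y | P.Visible u y} = ⋂ t ∈ Icc (0 : ℝ) 1, {y | u + t • (y - u) ∈ P.region} := by
    ext y
    simp only [Visible, segment_eq_image', image_subset_iff, mem_iInter]
    rfl
  rw [this]
  exact isClosed_biInter fun t _ => P.isClosed_region.preimage (by fun_prop)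

theorem visible_self {u : E2} (hu : u ∈ P.region) : P.Visible u u := by
  simpa [Visible, segment_same] using hu

theorem isPreconnected_image_line (a v : E2) {I : Set ℝ} (hI : IsPreconnected I) :
    IsPreconnected ((fun t : ℝ => a + t • v) '' I) :=
  hI.image _ (by fun_prop)

/-- If a connected set misses the region visible from `u`, it can be enlarged so that it has a
point of the visible region as an end of a segment. -/
theorem exists_first_visible {u : E2} (hu : u ∈ P.region) {p : E2} {S : Set E2}
    (hp : p ∈ S) (hS : IsPreconnected S) (hSP : S ⊆ P.region) (hSu : ∀ y ∈ S, ¬ P.Visible u y) :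
    ∃ H z q, IsPreconnected H ∧ S ⊆ H ∧ H ⊆ P.region ∧ (∀ y ∈ H, ¬ P.Visible u y) ∧
      P.Visible u z ∧ (∀ s ∈ Ioc (0 : ℝ) 1, z + s • (q - z) ∈ H) := by
  have hj : P.Joined p u := joined_of_mem (hSP hp) hu
  induction hj using Relation.ReflTransGen.head_induction_on generalizing S with
  | refl => exact absurd (visible_self hu) (hSu u hp)
  | @head a c hac _ ih =>
    by_cases hvis : ∃ y ∈ segment ℝ a c, P.Visible u y
    · have hcl : IsCompact (Icc (0 : ℝ) 1 ∩ {t | P.Visible u (a + t • (c - a))}) :=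
        isCompact_Icc.inter_right ((isClosed_setOf_visible (P := P) u).preimage
          (f := fun t : ℝ => a + t • (c - a)) (by fun_prop))
      have hne : (Icc (0 : ℝ) 1 ∩ {t | P.Visible u (a + t • (c - a))}).Nonempty := by
        obtain ⟨y, hy, hyv⟩ := hvis
        rw [segment_eq_image'] at hy
        obtain ⟨t, ht, rfl⟩ := hy
        exact ⟨t, ht, hyv⟩
      obtain ⟨t, ⟨ht, htv⟩, hmin⟩ := hcl.exists_isLeast hne
      have ht0 : 0 < t := by
        rcases ht.1.eq_or_lt with h | h
        · subst h
          exact absurd (by simpa using htv) (hSu a hp)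
        · exact h
      refine ⟨S ∪ (fun t : ℝ => a + t • (c - a)) '' Ico 0 t, a + t • (c - a), a,
        hS.union a hp ⟨0, ⟨le_rfl, ht0⟩, by simp⟩ (isPreconnected_image_line _ _ isPreconnected_Ico),
        subset_union_left, union_subset hSP ?_, ?_, htv, ?_⟩
      · rintro _ ⟨s, hs, rfl⟩
        refine hac ?_
        rw [segment_eq_image']
        exact ⟨s, ⟨hs.1, hs.2.le.trans ht.2⟩, rfl⟩
      · rintro y (hy | ⟨s, hs, rfl⟩)
        · exact hSu y hy
        · intro hv
          exact absurd (hmin ⟨⟨hs.1, hs.2.le.trans ht.2⟩, hv⟩) (not_le.2 hs.2)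
      · intro s hs
        refine Or.inr ⟨(1 - s) * t, ⟨by have := hs.2; nlinarith, by have := hs.1; nlinarith⟩, ?_⟩
        simp only
        module
    · push Not at hvis
      obtain ⟨H, z, q, h1, h2, h3⟩ := ih (S := S ∪ segment ℝ a c) (Or.inr (right_mem_segment ℝ a c))
        (hS.union a hp (left_mem_segment ℝ a c) (convex_segment a c).isPreconnected)
        (union_subset hSP hac) (by rintro y (hy | hy); exacts [hSu y hy, hvis y hy])
      exact ⟨H, z, q, h1, subset_union_left.trans h2, h3⟩

/-- The last time a path ending in a closed set is outside of this set. -/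
theorem exists_last_exit {f : ℝ → E2} (hf : Continuous f) {F : Set E2} (hF : IsClosed F)
    (h1 : f 1 ∈ F) (h : ∃ τ ∈ Icc (0 : ℝ) 1, f τ ∉ F) :
    ∃ ρ ∈ Ioc (0 : ℝ) 1, (∀ τ ∈ Icc ρ 1, f τ ∈ F) ∧
      ∀ ε > 0, ∃ τ ∈ Ico 0 ρ, ρ - ε < τ ∧ f τ ∉ F := by
  set O := {τ | τ ∈ Icc (0 : ℝ) 1 ∧ f τ ∉ F}
  have hne : O.Nonempty := h
  have hbdd : BddAbove O := ⟨1, fun τ hτ => hτ.1.2⟩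
  have hle : sSup O ≤ 1 := csSup_le hne fun τ hτ => hτ.1.2
  have hge : 0 ≤ sSup O := (h.choose_spec.1.1).trans (le_csSup hbdd h.choose_spec)
  have hgt : ∀ τ ∈ Ioc (sSup O) 1, f τ ∈ F := by
    intro τ hτ
    by_contra hc
    exact absurd (le_csSup hbdd ⟨⟨hge.trans hτ.1.le, hτ.2⟩, hc⟩) (not_le.2 hτ.1)
  have hmem : f (sSup O) ∈ F := by
    rcases hle.eq_or_lt with h | h
    · rwa [h]
    · have : sSup O ∈ closure (Ioc (sSup O) 1) := by
        rw [closure_Ioc h.ne]; exact ⟨le_rfl, h.le⟩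
      exact closure_minimal hgt (hF.preimage hf) this
  have hlt : ∀ τ ∈ O, τ < sSup O := fun τ hτ =>
    (le_csSup hbdd hτ).lt_of_ne fun e => hτ.2 (e ▸ hmem)
  refine ⟨sSup O, ⟨h.choose_spec.1.1.trans_lt (hlt _ h.choose_spec), hle⟩, fun τ hτ => ?_,
    fun ε hε => ?_⟩
  · rcases hτ.1.eq_or_lt with h | h
    · rwa [← h]
    · exact hgt τ ⟨h, hτ.2⟩
  · obtain ⟨τ, hτ, h⟩ := exists_lt_of_lt_csSup hne (sub_lt_self (sSup O) hε)
    exact ⟨τ, ⟨hτ.1.1, hlt τ hτ⟩, h, hτ.2⟩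

theorem visible_of_visible_smul {u v : E2} {a b : ℝ} (ha : 0 ≤ a) (hab : a ≤ b)
    (h : P.Visible u (u + b • v)) : u + a • v ∈ P.region := by
  rcases (ha.trans hab).eq_or_lt with rfl | hb
  · obtain rfl : a = 0 := le_antisymm hab ha
    exact h (right_mem_segment _ _ _)
  · refine h ?_
    rw [segment_eq_image']
    refine ⟨a / b, ⟨by positivity, (div_le_one hb).2 hab⟩, ?_⟩
    simp only [add_sub_cancel_left, smul_smul]
    rw [div_mul_cancel₀ _ hb.ne']

theorem visible_smul {u v : E2} {b : ℝ} (h : ∀ a ∈ Icc 0 b, u + a • v ∈ P.region) (hb : 0 ≤ b) :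
    P.Visible u (u + b • v) := by
  rw [Visible, segment_eq_image']
  rintro _ ⟨t, ht, rfl⟩
  simp only [add_sub_cancel_left, smul_smul]
  exact h _ ⟨mul_nonneg ht.1 hb, by nlinarith [ht.2]⟩

/-- The transversality of a segment leaving the region visible from `u`. -/
theorem cross2_ne_zero_of_visible {u z q : E2} (hz : P.Visible u z)
    (hzq : segment ℝ z q ⊆ P.region) (hq : ¬ P.Visible u q) : cross2 (z - u) (q - z) ≠ 0 := by
  intro h0
  refine hq ?_
  by_cases hD : z - u = 0
  · rw [sub_eq_zero] at hD
    exact hD ▸ hzq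
  obtain ⟨t, ht⟩ := exists_smul_of_orientedCross_eq_zero (σ := 1) one_ne_zero hD
    (b := q - z) (by rw [orientedCross, h0, mul_zero])
  have hq' : q = u + (1 + t) • (z - u) := by
    rw [add_smul, one_smul, ← ht]; abel
  rw [Visible, segment_eq_image']
  rintro _ ⟨τ, ⟨hτ0, hτ1⟩, rfl⟩
  have e : u + τ • (q - u) = u + (τ * (1 + t)) • (z - u) := by
    rw [mul_smul]; nth_rewrite 1 [hq']; rw [add_sub_cancel_left]
  simp only [e]
  set κ := τ * (1 + t) with hκ
  by_cases h1 : 0 ≤ κ ∧ κ ≤ 1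
  · refine visible_of_visible_smul h1.1 h1.2 ?_
    rwa [one_smul, add_sub_cancel]
  · refine hzq ?_
    rw [segment_eq_image']
    have ht0 : t ≠ 0 := by rintro rfl; apply h1; rw [hκ]; constructor <;> linarith
    refine ⟨(κ - 1) / t, ?_, ?_⟩
    · rcases lt_or_ge κ 0 with h2 | h2
      · have h3 : 1 + t < 0 := by by_contra! hc; nlinarith
        have : t < 0 := by linarith
        constructor
        · exact div_nonneg_of_nonpos (by linarith) this.le
        · rw [div_le_one_of_neg this]; nlinarith
      · have h3 : 1 < κ := by by_contra! hc; exact h1 ⟨h2, hc⟩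
        have : 0 < t := by by_contra! hc; nlinarith
        constructor
        · exact div_nonneg (by linarith) this.le
        · rw [div_le_one this]; nlinarith
    · simp only [ht, smul_smul]
      rw [div_mul_cancel₀ _ ht0, sub_smul, one_smul]
      abel

open Filter Topology in
/-- A connected set missing the region visible from `u` can be enlarged, keeping both properties,
so as to reach an edge at a boundary point `x` blocking the view from `u`. -/
theorem exists_blocking_point (hP : P.inner.Nonempty) {u : E2} (hu : u ∈ P.region) {S : Set E2}
    (hS : IsConnected S) (hSP : S ⊆ P.region) (hSu : ∀ y ∈ S, ¬ P.Visible u y) :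
    ∃ (σ : ℝ) (x d₁ d₂ : E2) (r : ℝ) (D : E2) (ρ c : ℝ) (H : Set E2),
      σ ≠ 0 ∧ P.LocalCone σ x d₁ d₂ r ∧ 0 < ρ ∧ x = u + ρ • D ∧ P.Visible u x ∧
      0 < orientedCross σ D d₂ ∧ 0 < c ∧ ‖c • d₂‖ < r ∧ IsPreconnected H ∧ S ⊆ H ∧
      H ⊆ P.region ∧ (∀ y ∈ H, ¬ P.Visible u y) ∧ x + c • d₂ ∈ H := by
  obtain ⟨p, hp⟩ := hS.1
  obtain ⟨H, z, q, hH, hSH, hHP, hHu, hz, hzq⟩ :=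
    exists_first_visible hu hp hS.2 hSP hSu
  have hqH : q ∈ H := by simpa using hzq 1 ⟨one_pos, le_rfl⟩
  have hzP : z ∈ P.region := hz (right_mem_segment _ _ _)
  have hσ : cross2 (z - u) (q - z) ≠ 0 := by
    refine cross2_ne_zero_of_visible hz ?_ (hHu q hqH)
    rw [segment_eq_image']
    rintro _ ⟨t, ht, rfl⟩
    rcases ht.1.eq_or_lt with rfl | h
    · simpa using hzP
    · exact hHP (hzq t ⟨h, ht.2⟩)
  set σ := cross2 (z - u) (q - z) with hσdef
  set D := z - u with hD
  set N := q - z with hN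
  have hDN : 0 < orientedCross σ D N := mul_self_pos.2 hσ
  -- the last exit on the segments from `u` to `z + s • N`
  have hexit : ∀ s : ℝ, s ∈ Ioc (0 : ℝ) 1 → ∃ ρ ∈ Ioc (0 : ℝ) 1,
      (∀ τ ∈ Icc ρ 1, u + τ • (D + s • N) ∈ P.region) ∧
      ∀ ε > 0, ∃ τ ∈ Ico 0 ρ, ρ - ε < τ ∧ u + τ • (D + s • N) ∉ P.region := by
    intro s hs
    have e : u + (1 : ℝ) • (D + s • N) = z + s • N := by rw [hD]; module
    refine exists_last_exit (f := fun τ : ℝ => u + τ • (D + s • N)) (by fun_prop)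
      P.isClosed_region ?_ ?_
    · simp only [e]; exact hHP (hzq s hs)
    · by_contra! hc
      refine hHu _ (hzq s hs) ?_
      rw [← e]
      exact visible_smul hc zero_le_one
  choose! ρ hρ hρin hρout using hexit
  have hs : ∀ k : ℕ, (1 / ((k : ℝ) + 1)) ∈ Ioc (0 : ℝ) 1 := fun k =>
    ⟨by positivity, by rw [div_le_one (by positivity)]; have : (0 : ℝ) ≤ k := by positivity
                       linarith⟩
  obtain ⟨ρ₀, hρ₀, φ, hφ, hlim⟩ := isCompact_Icc.tendsto_subseq
    (fun k : ℕ => Ioc_subset_Icc_self (hρ _ (hs k)))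
  have hslim : Tendsto (fun k => 1 / ((φ k : ℝ) + 1)) atTop (𝓝 0) :=
    (tendsto_one_div_add_atTop_nhds_zero_nat (𝕜 := ℝ)).comp hφ.tendsto_atTop
  have hyb : ∀ s ∈ Ioc (0 : ℝ) 1, u + ρ s • (D + s • N) ∈ P.boundary := by
    intro s hs
    by_contra hb
    have hin : u + ρ s • (D + s • N) ∈ P.inner := ⟨hρin s hs _ ⟨le_rfl, (hρ s hs).2⟩, hb⟩
    have hc : ContinuousAt (fun τ : ℝ => u + τ • (D + s • N)) (ρ s) := by fun_prop
    obtain ⟨ε, hε, h⟩ := Metric.eventually_nhds_iff.1 (hc.eventually (P.isOpen_inner.mem_nhds hin))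
    obtain ⟨τ, hτ, h1, h2⟩ := hρout s hs ε hε
    refine h2 (h ?_).1
    rw [Real.dist_eq, abs_sub_lt_iff]
    constructor <;> linarith [hτ.2]
  have hylim : Tendsto (fun k => u + ρ (1 / ((φ k : ℝ) + 1)) • (D + (1 / ((φ k : ℝ) + 1)) • N))
      atTop (𝓝 (u + ρ₀ • D)) := by
    have := (hlim.smul (tendsto_const_nhds.add (hslim.smul_const N) :
      Tendsto _ _ (𝓝 (D + (0 : ℝ) • N)))).const_add u
    simpa using this
  set x := u + ρ₀ • D with hx
  have hxb : x ∈ P.boundary := P.isClosed_boundary.mem_of_tendsto hylim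
    (Eventually.of_forall fun k => hyb _ (hs _))
  obtain ⟨d₁, d₂, r, hc⟩ := exists_localCone hP hσ hxb
  have hev : ∀ d, ∀ᶠ k in atTop, 0 < orientedCross σ D d →
      0 < orientedCross σ (D + (1 / ((φ k : ℝ) + 1)) • N) d := by
    intro d
    by_cases hd : 0 < orientedCross σ D d
    · have : Tendsto (fun k => orientedCross σ (D + (1 / ((φ k : ℝ) + 1)) • N) d) atTop
          (𝓝 (orientedCross σ D d)) := by
        simp only [orientedCross_add_left, orientedCross_smul_left]
        simpa using tendsto_const_nhds.add (hslim.mul_const (orientedCross σ N d))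
      filter_upwards [this.eventually (lt_mem_nhds hd)] with k hk _ using hk
    · exact Eventually.of_forall fun k h => absurd h hd
  obtain ⟨k, ⟨hk1, hk2⟩, hk3⟩ := (((hev d₁).and (hev d₂)).and
    (hylim.eventually (Metric.ball_mem_nhds x hc.pos))).exists
  have hsk := hs (φ k)
  set s := 1 / ((φ k : ℝ) + 1) with hsdef
  set Ds := D + s • N with hDs
  set y := u + ρ s • Ds with hy
  have hρs := hρ s hsk
  have hyr : ‖y - x‖ < r := by rwa [← dist_eq_norm]
  have hDy : 0 < orientedCross σ D (y - x) := by
    have : y - x = (ρ s - ρ₀) • D + (ρ s * s) • N := by rw [hy, hx, hDs]; module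
    rw [this, orientedCross_add_right, orientedCross_smul_right, orientedCross_smul_right,
      orientedCross_self]
    have := mul_pos (mul_pos hρs.1 hsk.1) hDN
    linarith
  have hray : ∃ c > (0 : ℝ), (y - x = c • d₁ ∧ 0 < orientedCross σ D d₁ ∨
      y - x = c • d₂ ∧ 0 < orientedCross σ D d₂) := by
    have hpos : ∀ d, OnRay d (y - x) → ∃ c > (0 : ℝ), y - x = c • d ∧ 0 < orientedCross σ D d := by
      rintro d ⟨c, hc0, h⟩
      rw [h, orientedCross_smul_right] at hDy
      have hcp : 0 < c := hc0.lt_of_ne fun e => by rw [← e] at hDy; simp at hDy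
      exact ⟨c, hcp, h, (mul_pos_iff_of_pos_left hcp).1 hDy⟩
    have hmem : x + (y - x) ∈ P.boundary := by rw [add_sub_cancel]; exact hyb s hsk
    rcases (hc.boundary_iff _ hyr).1 hmem with h | h
    · exact (hpos _ h).imp fun c h => ⟨h.1, Or.inl h.2⟩
    · exact (hpos _ h).imp fun c h => ⟨h.1, Or.inr h.2⟩
  obtain ⟨c, hcpos, hray⟩ := hray
  -- `x` is different from `u`
  have hρpos : 0 < ρ₀ := by
    refine hρ₀.1.lt_of_ne fun e => ?_
    have hyx : y - x = ρ s • Ds := by rw [hy, hx, ← e]; module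
    have hne : ∀ d, y - x = c • d → orientedCross σ Ds d = 0 := by
      intro d h
      have h1 : c * orientedCross σ Ds d = 0 := by
        rw [← orientedCross_smul_right, ← h, hyx, orientedCross_smul_right, orientedCross_self,
          mul_zero]
      exact (mul_eq_zero.1 h1).resolve_left hcpos.ne'
    rcases hray with ⟨h1, h2⟩ | ⟨h1, h2⟩
    · exact (hk1 h2).ne' (hne _ h1)
    · exact (hk2 h2).ne' (hne _ h1)
  have hd₂ : y - x = c • d₂ ∧ 0 < orientedCross σ D d₂ := by
    refine hray.resolve_left fun ⟨h1, h2⟩ => ?_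
    have hDs1 := hk1 h2
    have hn : ∀ᶠ ε : ℝ in 𝓝 0, ‖c • d₁ - ε • Ds‖ < r := by
      have : ContinuousAt (fun ε : ℝ => ‖c • d₁ - ε • Ds‖) 0 := by fun_prop
      refine this.eventually (gt_mem_nhds ?_)
      simpa [← h1] using hyr
    have hcr : ∀ᶠ ε : ℝ in 𝓝 0, 0 < orientedCross σ d₁ d₂ →
        0 < c * orientedCross σ d₁ d₂ - ε * orientedCross σ Ds d₂ := by
      by_cases hd : 0 < orientedCross σ d₁ d₂
      · have : ContinuousAt (fun ε : ℝ => c * orientedCross σ d₁ d₂ - ε * orientedCross σ Ds d₂)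
          0 := by fun_prop
        filter_upwards [this.eventually (lt_mem_nhds (a := 0) (by simpa using mul_pos hcpos hd))]
          with ε hε _ using hε
      · exact Eventually.of_forall fun ε h => absurd h hd
    obtain ⟨ε₀, hε₀, h⟩ := Metric.eventually_nhds_iff.1 (hn.and hcr)
    obtain ⟨τ, hτ, hτ1, hτ2⟩ := hρout s hsk ε₀ hε₀
    have hε : 0 < ρ s - τ := by linarith [hτ.2]
    obtain ⟨h3, h4⟩ := h (y := ρ s - τ) (by
      rw [Real.dist_eq, sub_zero, abs_of_pos hε]; linarith)
    have hpt : x + (c • d₁ - (ρ s - τ) • Ds) = u + τ • Ds := by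
      rw [← h1, hy]; module
    refine hτ2 (hpt ▸ (hc.inner_of _ h3 ?_).1)
    have h5 : 0 < orientedCross σ d₁ (c • d₁ - (ρ s - τ) • Ds) := by
      rw [orientedCross_sub_right, orientedCross_smul_right, orientedCross_smul_right,
        orientedCross_self, orientedCross_swap _ d₁ Ds]
      have := mul_pos hε hDs1
      linarith
    by_cases hd : 0 < orientedCross σ d₁ d₂
    · refine Or.inl ⟨hd, h5, ?_⟩
      rw [orientedCross_swap, orientedCross_sub_right, orientedCross_smul_right,
        orientedCross_smul_right, orientedCross_swap _ d₂ d₁, orientedCross_swap _ d₂ Ds]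
      have := h4 hd
      linarith
    · exact Or.inr ⟨not_lt.1 hd, Or.inl h5⟩
  have hyx : x + c • d₂ = y := by rw [← hd₂.1, add_sub_cancel]
  have hzs : u + (1 : ℝ) • Ds = z + s • N := by rw [hDs, hD]; module
  refine ⟨σ, x, d₁, d₂, r, D, ρ₀, c, H ∪ (fun τ : ℝ => u + τ • Ds) '' Icc (ρ s) 1, hσ, hc, hρpos,
    rfl, ?_, hd₂.2, hcpos, ?_, ?_, hSH.trans subset_union_left, union_subset hHP ?_, ?_, ?_⟩
  · refine visible_smul (fun a ha => visible_of_visible_smul ha.1 (ha.2.trans hρ₀.2) ?_) hρ₀.1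
    rwa [one_smul, hD, add_sub_cancel]
  · rwa [← hd₂.1]
  · refine hH.union (z + s • N) (hzq s hsk) ⟨1, ⟨hρs.2, le_rfl⟩, hzs⟩ ?_
    exact isPreconnected_image_line _ _ isPreconnected_Icc
  · rintro _ ⟨τ, hτ, rfl⟩
    exact hρin s hsk τ hτ
  · rintro w (hw | ⟨τ, hτ, rfl⟩)
    · exact hHu w hw
    · intro hv
      obtain ⟨τ', hτ', -, h⟩ := hρout s hsk 1 one_pos
      exact h (visible_of_visible_smul hτ'.1 (hτ'.2.le.trans hτ.1) hv)
  · rw [hyx]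
    exact Or.inr ⟨ρ s, ⟨le_rfl, hρs.2⟩, rfl⟩

theorem chord_separates_oriented (hP : P.inner.Nonempty) {σ : ℝ} (hσ : σ ≠ 0) {x b m : E2}
    (hx : x ∈ P.boundary) (hb : b ∈ P.boundary) (hxb : x ≠ b) (hm : m ∈ openSegment ℝ x b)
    {K : Set E2} (hK : IsPreconnected K) (hKP : K ⊆ P.region) (hKs : Disjoint (segment ℝ x b) K)
    (hl : m ∈ closure (K ∩ {z | 0 < orientedCross σ (b - x) (z - x)}))
    (hr : m ∈ closure (K ∩ {z | orientedCross σ (b - x) (z - x) < 0})) : False := by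
  simp only [orientedCross] at hl hr
  rcases lt_or_gt_of_ne hσ with h | h
  · simp only [mul_neg_iff, h, h.not_gt, mul_pos_iff, true_and, false_and, false_or] at hl hr
    exact chord_separates hP hx hb hxb hm hK hKP hKs hr hl
  · simp only [mul_neg_iff, h, h.not_gt, mul_pos_iff, true_and, false_and, or_false] at hl hr
    exact chord_separates hP hx hb hxb hm hK hKP hKs hl hr

/-- The wedge spanned by `e` and `v` at `x`, without the ray in direction `v`. -/
def wedge (x e v : E2) (c δ : ℝ) : Set E2 :=
  (fun p : ℝ × ℝ => x + (p.1 • e + p.2 • v)) '' Ioc 0 c ×ˢ Icc 0 δ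

theorem isPreconnected_wedge (x e v : E2) (c δ : ℝ) : IsPreconnected (wedge x e v c δ) :=
  (isPreconnected_Ioc.prod isPreconnected_Icc).image _ (by fun_prop)

theorem exists_norm_add_lt {e v : E2} {c r : ℝ} (hc : 0 < c) (hcr : ‖c • e‖ < r) :
    ∃ δ > (0 : ℝ), ∀ a ∈ Ioc 0 c, ∀ b ∈ Icc 0 δ, ‖a • e + b • v‖ < r := by
  refine ⟨(r - ‖c • e‖) / (‖v‖ + 1), div_pos (by linarith) (by positivity), fun a ha b hb => ?_⟩
  have h1 : ‖a • e‖ ≤ ‖c • e‖ := by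
    rw [norm_smul, norm_smul, Real.norm_of_nonneg ha.1.le, Real.norm_of_nonneg hc.le]
    gcongr
    exact ha.2
  have h2 : ‖b • v‖ < r - ‖c • e‖ := by
    rw [norm_smul, Real.norm_of_nonneg hb.1]
    have h3 := (le_div_iff₀ (by positivity)).1 hb.2
    rcases hb.1.eq_or_lt with h | h
    · rw [← h]; linarith
    · nlinarith
  linarith [norm_add_le (a • e) (b • v)]

theorem notMem_segment_of_orientedCross_ne {σ t : ℝ} {x v w : E2} (h : orientedCross σ v w ≠ 0) :
    x + w ∉ segment ℝ x (x + t • v) := by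
  rw [segment_eq_image']
  rintro ⟨τ, -, hτ⟩
  have hw : w = (τ * t) • v := by
    simp only [add_sub_cancel_left, smul_smul] at hτ
    exact (add_left_cancel hτ).symm
  exact h (by rw [hw, orientedCross_smul_right, orientedCross_self, mul_zero])

open Filter Topology in
/-- A chord cannot be bypassed: a connected set disjoint from it does not meet both wedges
adjacent to one of its ends. -/
theorem chord_separates_wedges (hP : P.inner.Nonempty) {σ : ℝ} (hσ : σ ≠ 0) {x v e f : E2}
    {t c c' r : ℝ} (hx : x ∈ P.boundary) (ht : 0 < t) (hb : x + t • v ∈ P.boundary)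
    (he : 0 < orientedCross σ v e) (hf : orientedCross σ v f < 0)
    (hc : 0 < c) (hc' : 0 < c') (hcr : ‖c • e‖ < r) (hcr' : ‖c' • f‖ < r)
    (heP : ∀ a > (0 : ℝ), ∀ b ≥ (0 : ℝ), ‖a • e + b • v‖ < r → x + (a • e + b • v) ∈ P.region)
    (hfP : ∀ a > (0 : ℝ), ∀ b ≥ (0 : ℝ), ‖a • f + b • v‖ < r → x + (a • f + b • v) ∈ P.region)
    {K : Set E2} (hK : IsPreconnected K) (hKP : K ⊆ P.region)
    (hKs : Disjoint (segment ℝ x (x + t • v)) K) (hKe : x + c • e ∈ K) (hKf : x + c' • f ∈ K) :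
    False := by
  have hv : v ≠ 0 := by rintro rfl; simp [orientedCross, cross2] at he
  obtain ⟨δ₁, hδ₁, h₁⟩ := exists_norm_add_lt (v := v) hc hcr
  obtain ⟨δ₂, hδ₂, h₂⟩ := exists_norm_add_lt (v := v) hc' hcr'
  set s := min (t / 2) (min δ₁ δ₂) with hs
  have hs0 : 0 < s := by positivity
  have hst : s < t := (min_le_left _ _).trans_lt (by linarith)
  have hs1 : s ≤ δ₁ := (min_le_right _ _).trans (min_le_left _ _)
  have hs2 : s ≤ δ₂ := (min_le_right _ _).trans (min_le_right _ _)
  have hmem : ∀ g : E2, ∀ k > (0 : ℝ), x + k • g ∈ wedge x g v k s := fun g k hk =>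
    ⟨(k, 0), ⟨⟨hk, le_rfl⟩, ⟨le_rfl, hs0.le⟩⟩, by simp⟩
  have hcross : ∀ g : E2, ∀ a b : ℝ,
      orientedCross σ v (a • g + b • v) = a * orientedCross σ v g := fun g a b => by
    rw [orientedCross_add_right, orientedCross_smul_right, orientedCross_smul_right,
      orientedCross_self, mul_zero, add_zero]
  have hdisj : ∀ g : E2, ∀ k, orientedCross σ v g ≠ 0 →
      Disjoint (segment ℝ x (x + t • v)) (wedge x g v k s) := by
    intro g k hg
    refine disjoint_right.2 ?_
    rintro _ ⟨⟨a, b⟩, ⟨ha, -⟩, rfl⟩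
    refine notMem_segment_of_orientedCross_ne (σ := σ) ?_
    rw [hcross]
    exact mul_ne_zero ha.1.ne' hg
  have hpre : IsPreconnected ((K ∪ wedge x e v c s) ∪ wedge x f v c' s) :=
    (hK.union _ hKe (hmem e c hc) (isPreconnected_wedge _ _ _ _ _)).union _ (Or.inl hKf)
      (hmem f c' hc') (isPreconnected_wedge _ _ _ _ _)
  have hclos : ∀ g : E2, ∀ k > (0 : ℝ), ∀ T : Set E2, (∀ ε ∈ Ioc 0 k, x + s • v + ε • g ∈ T) →
      x + s • v ∈ closure T := by
    intro g k hk T hT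
    have hlim : Tendsto (fun ε : ℝ => x + s • v + ε • g) (𝓝[>] 0) (𝓝 (x + s • v)) := by
      have : Continuous fun ε : ℝ => x + s • v + ε • g := by fun_prop
      simpa using (this.tendsto 0).mono_left nhdsWithin_le_nhds
    exact mem_closure_of_tendsto hlim
      (by filter_upwards [Ioc_mem_nhdsGT hk] with ε hε using hT ε hε)
  have hsub : ∀ g : E2, ∀ ε : ℝ, orientedCross σ (x + t • v - x) (x + s • v + ε • g - x) =
      t * (ε * orientedCross σ v g) := by
    intro g ε
    rw [add_sub_cancel_left, show x + s • v + ε • g - x = ε • g + s • v by module,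
      orientedCross_smul_left, hcross]
  have hin : ∀ g : E2, ∀ k : ℝ, ∀ ε ∈ Ioc 0 k, x + s • v + ε • g ∈ wedge x g v k s :=
    fun g k ε hε => ⟨(ε, s), ⟨hε, ⟨hs0.le, le_rfl⟩⟩, by simp only; module⟩
  refine chord_separates_oriented hP hσ hx hb ?_ (m := x + s • v) ?_ hpre ?_ ?_
    (hclos e c hc _ fun ε hε => ⟨Or.inl (Or.inr (hin e c ε hε)), ?_⟩)
    (hclos f c' hc' _ fun ε hε => ⟨Or.inr (hin f c' ε hε), ?_⟩)
  · intro h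
    have : t • v = 0 := by simpa using h.symm
    exact (smul_ne_zero ht.ne' hv) this
  · rw [openSegment_eq_image']
    refine ⟨s / t, ⟨by positivity, (div_lt_one ht).2 hst⟩, ?_⟩
    simp only [add_sub_cancel_left, smul_smul]
    rw [div_mul_cancel₀ _ ht.ne']
  · refine union_subset (union_subset hKP ?_) ?_
    · rintro _ ⟨⟨a, b⟩, ⟨ha, hb⟩, rfl⟩
      exact heP a ha.1 b hb.1 (h₁ a ha b ⟨hb.1, hb.2.trans hs1⟩)
    · rintro _ ⟨⟨a, b⟩, ⟨ha, hb⟩, rfl⟩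
      exact hfP a ha.1 b hb.1 (h₂ a ha b ⟨hb.1, hb.2.trans hs2⟩)
  · exact (hKs.union_right (hdisj e c he.ne')).union_right (hdisj f c' hf.ne)
  · rw [mem_ofPred_eq, hsub]
    exact mul_pos ht (mul_pos hε.1 he)
  · rw [mem_ofPred_eq, hsub]
    exact mul_neg_of_pos_of_neg ht (mul_neg_of_pos_of_neg hε.1 hf)

theorem exists_pos_norm_smul_lt (f : E2) {r : ℝ} (hr : 0 < r) :
    ∃ c > (0 : ℝ), ∀ a, 0 ≤ a → a ≤ c → ‖a • f‖ < r := by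
  refine ⟨r / (‖f‖ + 1), by positivity, fun a ha hac => ?_⟩
  rw [norm_smul, Real.norm_of_nonneg ha]
  rw [le_div_iff₀ (by positivity)] at hac
  rcases ha.eq_or_lt with rfl | h
  · simpa using hr
  · nlinarith

namespace LocalCone

variable {σ r : ℝ} {x d₁ d₂ : E2}

theorem mem_boundary (hc : P.LocalCone σ x d₁ d₂ r) : x ∈ P.boundary := by
  have := (hc.boundary_iff 0 (by simpa using hc.pos)).2 (Or.inl ⟨0, le_rfl, by simp⟩)
  simpa using this

theorem isReflex (hc : P.LocalCone σ x d₁ d₂ r) (h : 0 < orientedCross σ d₂ d₁) :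
    ∃ i j, x = P.vtx i ∧ (j = i + 1 ∨ j = i - 1) ∧ d₁ = P.vtx j - P.vtx i ∧ P.IsReflex i := by
  obtain ⟨ε₀, hε₀, hε⟩ := exists_pos_norm_smul_lt (d₁ + d₂) hc.pos
  have hsec : InSector σ d₂ d₁ (d₁ + d₂) := by
    refine Or.inl ⟨h, ?_, ?_⟩
    · rw [orientedCross_add_right, orientedCross_self, add_zero]; exact h
    · rw [orientedCross_add_left, orientedCross_self, zero_add]; exact h
  have hout : ∀ ε ∈ Ioo 0 ε₀, x + (ε / 2) • (d₁ + d₂) ∉ P.region := fun ε h' =>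
    hc.outer_of _ (hε _ (by linarith [h'.1]) (by linarith [h'.1, h'.2]))
      (hsec.smul (by linarith [h'.1]))
  have hmid : ∀ (ε : ℝ) (a b : E2), midpoint ℝ (x + ε • a) (x + ε • b) =
      x + (ε / 2) • (a + b) := by
    intro ε a b
    rw [midpoint_eq_smul_add, invOf_eq_inv]
    module
  rcases hc.vertex with ⟨i, hi, hd | hd⟩ | h0
  · refine ⟨i, i - 1, hi, Or.inr rfl, hi ▸ hd.1, ε₀, hε₀, fun ε h' => ?_⟩
    rw [← hi, ← hd.1, ← hd.2, hmid]
    exact hout ε h'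
  · refine ⟨i, i + 1, hi, Or.inl rfl, hi ▸ hd.1, ε₀, hε₀, fun ε h' => ?_⟩
    rw [← hi, ← hd.1, ← hd.2, hmid, add_comm d₂]
    exact hout ε h'
  · rw [orientedCross_swap, h0] at h
    simp at h

/-- The chord starting at `x` in a direction of the inner sector. -/
theorem exists_chord (hc : P.LocalCone σ x d₁ d₂ r) {v : E2} (hv : v ≠ 0)
    (h : InSector σ d₁ d₂ v) : ∃ t > (0 : ℝ), x + t • v ∈ P.boundary ∧
      ∀ s ∈ Ioo 0 t, x + s • v ∈ P.inner := by
  obtain ⟨δ, hδ, hsm⟩ := exists_pos_norm_smul_lt v hc.pos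
  exact P.exists_first_hit hv hδ fun t ht =>
    hc.inner_of _ (hsm t ht.1.le ht.2.le) (h.smul ht.1)

end LocalCone

theorem mem_region_of_chord {x v : E2} {t : ℝ} (hx : x ∈ P.boundary) (ht : x + t • v ∈ P.boundary)
    (h : ∀ s ∈ Ioo 0 t, x + s • v ∈ P.inner) : ∀ s ∈ Icc 0 t, x + s • v ∈ P.region := by
  intro s hs
  rcases hs.1.eq_or_lt with rfl | h0
  · simpa using P.boundary_subset_region hx
  rcases hs.2.eq_or_lt with rfl | h1
  · exact P.boundary_subset_region ht
  · exact (h s ⟨h0, h1⟩).1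

theorem mem_segment_smul {x v y : E2} {t : ℝ} (ht : 0 ≤ t) (hy : y ∈ segment ℝ x (x + t • v)) :
    ∃ s ∈ Icc 0 t, y = x + s • v := by
  rw [segment_eq_image'] at hy
  obtain ⟨θ, hθ, rfl⟩ := hy
  refine ⟨θ * t, ⟨mul_nonneg hθ.1 ht, by nlinarith [hθ.2]⟩, ?_⟩
  simp only [add_sub_cancel_left, smul_smul]

/-- The segment prolonging the line of sight from `u` to `x` is visible from `u`. -/
theorem visible_prolongation {u x D : E2} {ρ t : ℝ} (hρ : 0 ≤ ρ) (hx : x = u + ρ • D)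
    (hux : P.Visible u x) (h : ∀ s ∈ Icc 0 t, x + s • D ∈ P.region) :
    ∀ s ∈ Icc 0 t, P.Visible u (x + s • D) := by
  intro s hs
  have e : x + s • D = u + (ρ + s) • D := by rw [hx]; module
  rw [e]
  refine visible_smul (fun a ha => ?_) (add_nonneg hρ hs.1)
  rcases le_total a ρ with h1 | h1
  · exact visible_of_visible_smul ha.1 h1 (hx ▸ hux)
  · have : u + a • D = x + (a - ρ) • D := by rw [hx]; module
    rw [this]
    exact h _ ⟨by linarith, by linarith [ha.2, hs.2]⟩

/-- If a connected set invisible from `u` reaches an edge at a point `x` blocking the view from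
`u`, then it misses the pocket of a cut at `x`. -/
theorem LocalCone.exists_cut_disjoint (hP : P.inner.Nonempty) {σ r ρ c : ℝ} {u x d₁ d₂ D : E2}
    {H : Set E2} (hσ : σ ≠ 0) (hc : P.LocalCone σ x d₁ d₂ r) (hρ : 0 < ρ) (hx : x = u + ρ • D)
    (hux : P.Visible u x) (hD₂ : 0 < orientedCross σ D d₂) (hc0 : 0 < c) (hcr : ‖c • d₂‖ < r)
    (hH : IsPreconnected H) (hHP : H ⊆ P.region) (hHu : ∀ y ∈ H, ¬ P.Visible u y)
    (hh : x + c • d₂ ∈ H) : ∃ C : P.Cut, Disjoint H C.pocket := by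
  have hxb := hc.mem_boundary
  have hD : D ≠ 0 := by rintro rfl; simp [orientedCross, cross2] at hD₂
  -- the direction of `u` is not in the outer sector
  have hout : ¬ InSector σ d₂ d₁ (-D) := by
    intro hs
    obtain ⟨δ, hδ, hsm⟩ := exists_pos_norm_smul_lt (-D) hc.pos
    have hε : 0 < min δ ρ := lt_min hδ hρ
    refine hc.outer_of _ (hsm _ hε.le (min_le_left _ _)) (hs.smul hε) ?_
    have e : x + min δ ρ • (-D) = u + (ρ - min δ ρ) • D := by rw [hx]; module
    rw [e]
    exact visible_of_visible_smul (sub_nonneg.2 (min_le_right _ _)) (by linarith) (hx ▸ hux)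
  have hneg : 0 < orientedCross σ d₂ (-D) := by
    rwa [orientedCross_neg_right, orientedCross_swap, neg_neg]
  have h21 : 0 < orientedCross σ d₂ d₁ := by
    by_contra! h
    exact hout (Or.inr ⟨h, Or.inl hneg⟩)
  have h12 : orientedCross σ d₁ d₂ < 0 := by rw [orientedCross_swap]; linarith
  have hD₁ : 0 ≤ orientedCross σ D d₁ := by
    by_contra! h
    exact hout (Or.inl ⟨h21, hneg, by rw [orientedCross_neg_left]; linarith⟩)
  obtain ⟨i, j, hxi, hij, hd₁, hrefl⟩ := hc.isReflex h21
  -- the cut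
  obtain ⟨t, ht, htb, hti⟩ := hc.exists_chord (neg_ne_zero.2 hc.ne₁)
    (Or.inr ⟨h12.le, Or.inr (by rw [orientedCross_neg_left]; linarith)⟩)
  have htP := mem_region_of_chord hxb htb hti
  have hseg : ∀ y ∈ segment ℝ x (x + t • (-d₁)), ∃ s ∈ Icc 0 t, y = x + s • (-d₁) :=
    fun y hy => mem_segment_smul ht.le hy
  have hd₁' : P.vtx i - P.vtx j = -d₁ := by rw [hd₁]; abel
  let C : P.Cut :=
    { i := i, j := j, adj := hij, reflex := hrefl, t := t, t_pos := ht
      hits := by rw [hd₁', ← hxi]; exact htb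
      first_hit := fun s hs => by rw [hd₁', ← hxi]; exact (hti s hs).2
      inside := by
        rw [hd₁', ← hxi]
        intro y hy
        obtain ⟨s, hs, rfl⟩ := hseg y hy
        exact htP s hs }
  have hCseg : C.seg = segment ℝ x (x + t • (-d₁)) := by
    change segment ℝ (P.vtx i) (P.vtx i + t • (P.vtx i - P.vtx j)) = _
    rw [hd₁', ← hxi]
  have hCu : C.u = x + d₁ := by
    change P.vtx j = _
    rw [hd₁, hxi]; abel
  have hedge : ∀ s ∈ Icc (0 : ℝ) 1, x + s • d₁ ∈ P.boundary := by
    intro s hs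
    have hseg₁ : x + s • d₁ ∈ segment ℝ (P.vtx i) (P.vtx j) := by
      rw [segment_eq_image']
      exact ⟨s, hs, by rw [hxi, hd₁]⟩
    rcases hij with rfl | rfl
    · exact P.edge_subset_boundary i hseg₁
    · refine P.edge_subset_boundary (i - 1) ?_
      rw [sub_add_cancel, segment_symm]
      exact hseg₁
  -- the wedge next to `d₂`
  have hwedge : ∀ v, 0 < orientedCross σ v d₂ → ∀ a > (0 : ℝ), ∀ b ≥ (0 : ℝ),
      ‖a • d₂ + b • v‖ < r → x + (a • d₂ + b • v) ∈ P.region := by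
    intro v hv a ha b hb hn
    rcases hb.eq_or_lt with h0 | h0
    · refine P.boundary_subset_region ((hc.boundary_iff _ hn).2 (Or.inr ⟨a, ha.le, ?_⟩))
      rw [← h0]; simp
    · refine (hc.inner_of _ hn (Or.inr ⟨h12.le, Or.inr ?_⟩)).1
      rw [orientedCross_add_left, orientedCross_smul_left, orientedCross_smul_left,
        orientedCross_self]
      have := mul_pos h0 hv
      linarith
  -- `H` misses the cut
  have hHC : Disjoint (segment ℝ x (x + t • (-d₁))) H := by
    refine disjoint_left.2 fun y hy hyH => ?_
    obtain ⟨s, hs, rfl⟩ := hseg y hy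
    have hs0 : 0 < s := hs.1.lt_of_ne fun e => by
      rw [← e] at hyH
      exact hHu _ hyH (by simpa using hux)
    rcases hD₁.eq_or_lt with h0 | hD₁
    · obtain ⟨μ, hμ⟩ := exists_smul_of_orientedCross_eq_zero hσ hD h0.symm
      have hμ0 : 0 < -μ := by
        rw [hμ, orientedCross_smul_right, orientedCross_swap] at h21
        nlinarith
      refine hHu _ hyH ?_
      have e : ∀ a : ℝ, x + a • (-d₁) = x + (a * -μ) • D := fun a => by rw [hμ]; module
      rw [e]
      refine visible_prolongation (t := t * -μ) hρ.le hx hux (fun a ha => ?_) _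
        ⟨mul_nonneg hs.1 hμ0.le, mul_le_mul_of_nonneg_right hs.2 hμ0.le⟩
      have := htP (a / -μ) ⟨div_nonneg ha.1 hμ0.le, (div_le_iff₀ hμ0).2 ha.2⟩
      rwa [e, div_mul_cancel₀ _ hμ0.ne'] at this
    · obtain ⟨t', ht', htb', hti'⟩ := hc.exists_chord hD (Or.inr ⟨h12.le, Or.inr hD₂⟩)
      obtain ⟨δ, hδ, hsm⟩ := exists_pos_norm_smul_lt (-d₁) hc.pos
      have hε : 0 < min δ s := lt_min hδ hs0
      refine chord_separates_wedges hP hσ hxb ht' htb' hD₂ (f := -d₁) (c' := min δ s)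
        (K := H ∪ (fun τ : ℝ => x + τ • (-d₁)) '' Ioc 0 s)
        (by rw [orientedCross_neg_right]; linarith) hc0 hε hcr (hsm _ hε.le (min_le_left _ _))
        (hwedge D hD₂) (fun a ha b hb hn => (hc.inner_of _ hn (Or.inr ⟨h12.le, Or.inr ?_⟩)).1)
        (hH.union _ hyH ⟨s, ⟨hs0, le_rfl⟩, rfl⟩ (isPreconnected_image_line _ _ isPreconnected_Ioc))
        (union_subset hHP ?_) (Disjoint.union_right ?_ ?_) (Or.inl hh)
        (Or.inr ⟨_, ⟨hε, min_le_right _ _⟩, rfl⟩)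
      · rw [orientedCross_add_left, orientedCross_smul_left, orientedCross_smul_left,
          orientedCross_neg_left]
        have := mul_nonneg hb hD₂.le
        nlinarith
      · rintro _ ⟨τ, hτ, rfl⟩
        exact htP τ ⟨hτ.1.le, hτ.2.trans hs.2⟩
      · refine disjoint_left.2 fun y hy hyH => ?_
        obtain ⟨a, ha, rfl⟩ := mem_segment_smul ht'.le hy
        exact hHu _ hyH (visible_prolongation hρ.le hx hux
          (mem_region_of_chord hxb htb' hti') a ha)
      · refine disjoint_right.2 ?_
        rintro _ ⟨τ, hτ, rfl⟩
        refine notMem_segment_of_orientedCross_ne (σ := σ) ?_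
        rw [orientedCross_smul_right, orientedCross_neg_right]
        exact mul_ne_zero hτ.1.ne' (neg_ne_zero.2 hD₁.ne')
  refine ⟨C, disjoint_left.2 fun p hpH hp => ?_⟩
  rw [Cut.pocket, pocketOfSeg, hCseg, hCu] at hp
  rcases hp with hp | hp
  swap
  · exact hHC.ne_of_mem hp hpH rfl
  -- a connected set in the complement of the cut joining both sides of the cut
  have hpos : ∀ s > (0 : ℝ), x + s • d₁ ∉ segment ℝ x (x + t • (-d₁)) := by
    intro s hs hmem
    obtain ⟨a, ha, e⟩ := hseg _ hmem
    have : (s + a) • d₁ = 0 := by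
      have := add_left_cancel e
      rw [add_smul, this]; module
    exact (smul_ne_zero (by linarith [ha.1]) hc.ne₁) this
  have hu1 : x + d₁ ∈ P.region \ segment ℝ x (x + t • (-d₁)) := by
    have h1 := hedge 1 ⟨zero_le_one, le_rfl⟩
    have h2 := hpos 1 one_pos
    rw [one_smul] at h1 h2
    exact ⟨P.boundary_subset_region h1, h2⟩
  set A := connectedComponentIn (P.region \ segment ℝ x (x + t • (-d₁))) (x + d₁) with hA
  have hAsub : A ⊆ P.region \ segment ℝ x (x + t • (-d₁)) := connectedComponentIn_subset _ _
  have hApre : IsPreconnected (insert p A) :=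
    isPreconnected_connectedComponentIn.subset_closure (subset_insert _ _)
      (insert_subset hp subset_closure)
  obtain ⟨δ₁, hδ₁, hsm₁⟩ := exists_pos_norm_smul_lt d₁ (half_pos hc.pos)
  obtain ⟨δ₂, hδ₂, hsm₂⟩ := exists_pos_norm_smul_lt (-d₂) (half_pos hc.pos)
  set ε := min 1 (min δ₁ δ₂) with hεdef
  have hε : 0 < ε := by positivity
  have hε1 : ε ≤ 1 := min_le_left _ _
  have hεδ₁ : ε ≤ δ₁ := (min_le_right _ _).trans (min_le_left _ _)
  have hεδ₂ : ε ≤ δ₂ := (min_le_right _ _).trans (min_le_right _ _)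
  have hbridge : ∀ l ∈ Icc (0 : ℝ) 1, x + ((ε * (1 - l)) • d₁ + (ε * l) • (-d₂)) ∈
      P.region \ segment ℝ x (x + t • (-d₁)) := by
    intro l hl
    rcases hl.1.eq_or_lt with h0 | h0
    · rw [← h0]
      simp only [sub_zero, mul_one, mul_zero, zero_smul, add_zero]
      exact ⟨P.boundary_subset_region (hedge ε ⟨hε.le, hε1⟩), hpos ε hε⟩
    · have hcr : 0 < orientedCross σ d₁ ((ε * (1 - l)) • d₁ + (ε * l) • (-d₂)) := by
        rw [orientedCross_add_right, orientedCross_smul_right, orientedCross_smul_right,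
          orientedCross_self, orientedCross_neg_right]
        have := mul_pos (mul_pos hε h0) (neg_pos.2 h12)
        linarith
      refine ⟨(hc.inner_of _ ?_ (Or.inr ⟨h12.le, Or.inl hcr⟩)).1,
        notMem_segment_of_orientedCross_ne (σ := σ) ?_⟩
      · refine (norm_add_le _ _).trans_lt ?_
        have h1 := hsm₁ (ε * (1 - l)) (mul_nonneg hε.le (by linarith [hl.2])) (by nlinarith)
        have h2 := hsm₂ (ε * l) (mul_nonneg hε.le hl.1) (by nlinarith [hl.2])
        linarith
      · rw [orientedCross_neg_left]
        exact (neg_lt_zero.2 hcr).ne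
  set B := (fun l : ℝ => x + ((ε * (1 - l)) • d₁ + (ε * l) • (-d₂))) '' Icc 0 1 with hB
  set I := (fun s : ℝ => x + s • d₁) '' Ioc 0 1 with hI
  have hIpre : IsPreconnected I := isPreconnected_image_line _ _ isPreconnected_Ioc
  have hBpre : IsPreconnected B := isPreconnected_Icc.image _ (by fun_prop)
  have hI1 : x + d₁ ∈ I := ⟨1, ⟨one_pos, le_rfl⟩, by simp⟩
  have hIε : x + ε • d₁ ∈ I := ⟨ε, ⟨hε, hε1⟩, rfl⟩
  have hBε : x + ε • d₁ ∈ B := ⟨0, ⟨le_rfl, zero_le_one⟩, by simp⟩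
  have hpre : IsPreconnected (((insert p A ∪ H) ∪ I) ∪ B) :=
    ((hApre.union p (mem_insert _ _) hpH hH).union (x + d₁)
      (Or.inl (Or.inr (mem_connectedComponentIn hu1))) hI1 hIpre).union (x + ε • d₁)
      (Or.inr hIε) hBε hBpre
  have hsub : (((insert p A ∪ H) ∪ I) ∪ B) ⊆ P.region \ segment ℝ x (x + t • (-d₁)) := by
    have hHs : H ⊆ P.region \ segment ℝ x (x + t • (-d₁)) := fun y hy =>
      ⟨hHP hy, fun h => hHC.ne_of_mem h hy rfl⟩
    refine union_subset (union_subset (union_subset (insert_subset (hHs hpH) hAsub) hHs) ?_) ?_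
    · rintro _ ⟨s, hs, rfl⟩
      exact ⟨P.boundary_subset_region (hedge s ⟨hs.1.le, hs.2⟩), hpos s hs.1⟩
    · rintro _ ⟨l, hl, rfl⟩
      exact hbridge l hl
  refine chord_separates_wedges hP hσ hxb ht htb (e := d₂) (f := -d₂) (c' := ε)
    (by rw [orientedCross_neg_left]; linarith)
    (by rw [orientedCross_neg_left, orientedCross_neg_right]; linarith) hc0 hε hcr
    ((hsm₂ ε hε.le hεδ₂).trans (half_lt_self hc.pos))
    (hwedge _ (by rw [orientedCross_neg_left]; linarith)) (fun a ha b hb hn => ?_) hpre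
    (hsub.trans sdiff_subset) (disjoint_right.2 fun y hy => (hsub hy).2)
    (Or.inl (Or.inl (Or.inr hh))) (Or.inr ⟨1, ⟨zero_le_one, le_rfl⟩, by simp⟩)
  refine (hc.inner_of _ hn (Or.inr ⟨h12.le, Or.inl ?_⟩)).1
  rw [orientedCross_add_right, orientedCross_smul_right, orientedCross_smul_right,
    orientedCross_neg_right, orientedCross_neg_right, orientedCross_self]
  have := mul_pos ha (neg_pos.2 h12)
  linarith

instance : Finite P.Cut := by
  refine Finite.of_injective (fun C : P.Cut => (C.i, C.j)) ?_
  rintro ⟨i, j, _, _, t, ht, hh, hf, _⟩ ⟨i', j', _, _, t', ht', hh', hf', _⟩ h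
  simp only [Prod.mk.injEq] at h
  obtain ⟨rfl, rfl⟩ := h
  obtain rfl : t = t' := by
    rcases lt_trichotomy t t' with h | h | h
    · exact absurd hh (hf' t ⟨ht, h⟩)
    · exact h
    · exact absurd hh' (hf t' ⟨ht', h⟩)
  rfl

theorem Cut.exists_nonredundant_pocket_subset (C : P.Cut) :
    ∃ C₀ : P.Cut, C₀.Nonredundant ∧ C₀.pocket ⊆ C.pocket := by
  obtain ⟨C₀, h₀, hmin⟩ := (Set.toFinite {C' : P.Cut | C'.pocket ⊆ C.pocket}).exists_minimalFor
    Cut.pocket _ ⟨C, (Subset.rfl : C.pocket ⊆ C.pocket)⟩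
  refine ⟨C₀, ?_, h₀⟩
  rintro ⟨C', hC'⟩
  exact hC'.2 (hmin (hC'.1.trans h₀) hC'.1)

/-- A connected subset of a polygon meeting every nonredundant cut sees the whole polygon. -/
theorem exists_visible_of_meets_nonredundant_cuts (hP : P.inner.Nonempty) {S : Set E2}
    (hSP : S ⊆ P.region) (hS : IsConnected S)
    (hcuts : ∀ C : P.Cut, C.Nonredundant → (S ∩ C.seg).Nonempty) {u : E2} (hu : u ∈ P.region) :
    ∃ p ∈ S, P.Visible u p := by
  by_contra! hSu
  obtain ⟨σ, x, d₁, d₂, r, D, ρ, c, H, hσ, hc, hρ, hx, hux, hD₂, hc0, hcr, hH, hSH, hHP, hHu, hh⟩ :=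
    exists_blocking_point hP hu hS hSP hSu
  obtain ⟨C, hC⟩ := hc.exists_cut_disjoint hP hσ hρ hx hux hD₂ hc0 hcr hH hHP hHu hh
  obtain ⟨C₀, hC₀, hsub⟩ := C.exists_nonredundant_pocket_subset
  obtain ⟨p, hpS, hp⟩ := hcuts C₀ hC₀
  exact hC.ne_of_mem (hSH hpS) (hsub (Or.inr hp)) rfl

theorem Cut.inner_nonempty (C : P.Cut) : P.inner.Nonempty := by
  have hs : C.t / 2 ∈ Ioo 0 C.t := ⟨half_pos C.t_pos, half_lt_self C.t_pos⟩
  refine ⟨_, C.inside ?_, C.first_hit _ hs⟩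
  rw [segment_eq_image']
  refine ⟨1 / 2, by norm_num, ?_⟩
  simp only [add_sub_cancel_left, smul_smul]
  ring_nf

theorem core_subset_region : P.core ⊆ P.region :=
  closure_minimal sdiff_subset P.isClosed_region

end SimplePolygon

/-- Let `Q = P.core` be realized as a simple polygon `R`, let `Pth`
be a connected curve inside `P` intersecting every nonredundant cut of `P`, and let
`C'` be a cut of `R` (generated at a reflex vertex `v_i` of `Q` by the edge `t_{ij} v_i`).
If the pocket of `C'` taken in `P` contains the pocket of every nonredundant cut of `P`,
then the vertex `t_{ij} = C'.u` is visible from some point of `Pth`. -/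
theorem core_cut_generator_visible
    (P : SimplePolygon) (R : SimplePolygon) (hR : R.region = P.core)
    (Pth : Set E2) (hsub : Pth ⊆ P.region) (hconn : IsConnected Pth)
    (hcuts : ∀ C : P.Cut, C.Nonredundant → (Pth ∩ C.seg).Nonempty)
    (C' : R.Cut)
    (hall : ∀ C : P.Cut, C.Nonredundant → C.pocket ⊆ P.pocketOfSeg C'.seg C'.u) :
    ∃ p ∈ Pth, P.Visible C'.u p := by
  have hRP : R.region ⊆ P.region := hR ▸ SimplePolygon.core_subset_region
  obtain ⟨y, hy, hyb⟩ :=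
    SimplePolygon.exists_mem_not_boundary (P := P) R.isOpen_inner C'.inner_nonempty
  exact SimplePolygon.exists_visible_of_meets_nonredundant_cuts ⟨y, hRP hy.1, hyb⟩ hsub hconn
    hcuts (hRP (R.boundary_subset_region (R.vtx_mem_boundary C'.j)))
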